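/- arXiv:2102.09438 — 6 statements merged into one kernel-verified Lean document; each statement's English description precedes it below -/
import Mathlib

section
/- Let a > b > 0, c² = a² − b², and a_c ≥ b_c > 0 satisfy the Cayley condition −c²·a_c² + (a·b + a·b_c + a_c·b)(a·b − a·b_c − a_c·b) = 0. Let E = {(x,y) ∈ ℝ² : (b² + c²)x² − 2ac·xy + a²y² = a²b²} and E_c = {(x,y) ∈ ℝ² : x²/a_c² + y²/b_c² = 1}. Then for every triangle with vertices P₁, P₂, P₃ on E that circumscribes E_c, the power of the origin with respect to the circumcircle equals −(a·b_c/(b·a_c))·(b² + a_c² − b_c²) − (a_c² − b_c²), and the power of the origin with respect to the nine-point circle equals −(a·b_c/(2·b·a_c))·(b² + a_c² − b_c²) + b_c². -/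
open scoped RealInnerProductSpace

noncomputable section

/-- Points of the Euclidean plane. -/
abbrev Pt := EuclideanSpace ℝ (Fin 2)

/-- The sideline through two points `A`, `B`. -/
def sideline (A B : Pt) : Set Pt := {X | ∃ t : ℝ, X = A + t • (B - A)}

/-- A line `L` is tangent to a conic `C` if it meets `C` in exactly one point. -/
def IsTangentLine (L C : Set Pt) : Prop := ∃! Q, Q ∈ L ∩ C

/-- A triangle `P₁P₂P₃` circumscribes `C` when each sideline is tangent to `C`
and `C` is contained in the convex hull of the vertices. -/
def Circumscribes (P₁ P₂ P₃ : Pt) (C : Set Pt) : Prop :=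
  IsTangentLine (sideline P₁ P₂) C ∧ IsTangentLine (sideline P₂ P₃) C ∧
  IsTangentLine (sideline P₃ P₁) C ∧ C ⊆ convexHull ℝ {P₁, P₂, P₃}

/-- The power of a point `X` with respect to the circle with center `C` and radius `ρ`. -/
def circlePower (X C : Pt) (ρ : ℝ) : ℝ := dist X C ^ 2 - ρ ^ 2

open scoped ComplexConjugate

lemma mul_conj_mk (x y : ℝ) : (⟨x, y⟩ : ℂ) * conj (⟨x, y⟩ : ℂ) = ((x ^ 2 + y ^ 2 : ℝ) : ℂ) := by
  rw [Complex.mul_conj, Complex.normSq_mk, pow_two, pow_two]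

lemma mul_conj_mk_eq_one {x y : ℝ} (h : x ^ 2 + y ^ 2 = 1) :
    (⟨x, y⟩ : ℂ) * conj (⟨x, y⟩ : ℂ) = 1 := by
  rw [mul_conj_mk, h, Complex.ofReal_one]

/-- If the chords `uv` and `uw` of the unit circle are tangent to the central ellipse whose foci are
the square roots of `F` and whose semi-axes add up to `1`, then the second elementary symmetric
function of the three endpoints is `-F`. -/
lemma sum_mul_eq_neg_of_chords_tangent {u v w F : ℂ} (hu : u * conj u = 1)
    (hF : F * conj F ≠ 1) (hvw : v ≠ w)
    (huv : (u + v) ^ 2 - F - u ^ 2 * v ^ 2 * conj F - (1 + F * conj F) * (u * v) = 0)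
    (huw : (u + w) ^ 2 - F - u ^ 2 * w ^ 2 * conj F - (1 + F * conj F) * (u * w) = 0) :
    u * v + u * w + v * w = -F := by
  have hK : 1 - u ^ 2 * conj F ≠ 0 := by
    intro h
    have h1 : u ^ 2 * conj F = 1 := by linear_combination -h
    have h2 : conj u ^ 2 * F = 1 := by simpa using congrArg conj h1
    apply hF
    linear_combination (conj u ^ 2 * F) * h1 + h2 - F * conj F * (u * conj u + 1) * hu
  have hsum : (1 - u ^ 2 * conj F) * (v + w) + (1 - F * conj F) * u = 0 := by
    apply mul_left_cancel₀ (sub_ne_zero.mpr hvw)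
    linear_combination huv - huw
  apply mul_left_cancel₀ hK
  linear_combination (u + v) * hsum - huv

/-- A trigonometric polynomial of degree at most two, written on the unit circle in terms of `z` and
its inverse `z'`, has its constant term determined by its second-order terms and three of
its zeros. -/
lemma const_eq_of_three_zeros {u v w u' v' w' A B C D k : ℂ}
    (hu : u * u' = 1) (hv : v * v' = 1) (hw : w * w' = 1)
    (huv : u ≠ v) (hvw : v ≠ w) (hwu : w ≠ u)
    (eu : A * u ^ 2 + B * u' ^ 2 + C * u + D * u' + k = 0)
    (ev : A * v ^ 2 + B * v' ^ 2 + C * v + D * v' + k = 0)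
    (ew : A * w ^ 2 + B * w' ^ 2 + C * w + D * w' + k = 0) :
    k = A * (u * v + u * w + v * w) + B * (u' * v' + u' * w' + v' * w') := by
  set e₁ := u + v + w with he₁
  set e₂ := u * v + u * w + v * w with he₂
  set f₁ := u' + v' + w' with hf₁
  set f₂ := u' * v' + u' * w' + v' * w' with hf₂
  have red : ∀ z z' : ℂ, z * z' = 1 →
      z ^ 3 - e₁ * z ^ 2 + e₂ * z - u * v * w = 0 →
      z' ^ 3 - f₁ * z' ^ 2 + f₂ * z' - u' * v' * w' = 0 →
      A * z ^ 2 + B * z' ^ 2 + C * z + D * z' + k = 0 →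
      (A * e₁ + C + B * (u' * v' * w')) * z ^ 2 + (k - A * e₂ - B * f₂) * z
        + (A * (u * v * w) + B * f₁ + D) = 0 := by
    intro z z' hz h3 h3' h
    have a1 : z ^ 2 = e₁ * z - e₂ + u * v * w * z' := by
      linear_combination z' * h3 - (z ^ 2 - e₁ * z + e₂) * hz
    have a2 : z' ^ 2 = f₁ * z' - f₂ + u' * v' * w' * z := by
      linear_combination z * h3' - (z' ^ 2 - f₁ * z' + f₂) * hz
    have h' : (A * e₁ + C + B * (u' * v' * w')) * z + (k - A * e₂ - B * f₂)
        + (A * (u * v * w) + B * f₁ + D) * z' = 0 := by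
      linear_combination h - A * a1 - B * a2
    linear_combination z * h' - (A * (u * v * w) + B * f₁ + D) * hz
  have ru := red u u' hu (by rw [he₁, he₂]; ring) (by rw [hf₁, hf₂]; ring) eu
  have rv := red v v' hv (by rw [he₁, he₂]; ring) (by rw [hf₁, hf₂]; ring) ev
  have rw' := red w w' hw (by rw [he₁, he₂]; ring) (by rw [hf₁, hf₂]; ring) ew
  generalize A * e₁ + C + B * (u' * v' * w') = X at ru rv rw'
  generalize A * (u * v * w) + B * f₁ + D = Z at ru rv rw'
  have q1 : X * (u + v) + (k - A * e₂ - B * f₂) = 0 := by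
    apply mul_left_cancel₀ (sub_ne_zero.mpr huv)
    linear_combination ru - rv
  have q2 : X * (v + w) + (k - A * e₂ - B * f₂) = 0 := by
    apply mul_left_cancel₀ (sub_ne_zero.mpr hvw)
    linear_combination rv - rw'
  have hX : X = 0 := by
    apply mul_left_cancel₀ (sub_ne_zero.mpr hwu)
    linear_combination q2 - q1
  linear_combination q1 - (u + v) * hX

/-- The tangency condition of a chord of the unit circle with a central ellipse, in complex form. -/
lemma chord_tangent_complex {C₁ S₁ C₂ S₂ p q τ : ℝ}
    (h₁ : C₁ ^ 2 + S₁ ^ 2 = 1) (h₂ : C₂ ^ 2 + S₂ ^ 2 = 1)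
    (hne : (⟨C₁, S₁⟩ : ℂ) ≠ ⟨C₂, S₂⟩) (hτ : 2 * τ = 1 + (p ^ 2 + q ^ 2))
    (h : (τ + p) / 2 * (S₁ - S₂) ^ 2 - q * (S₁ - S₂) * (C₁ - C₂) + (τ - p) / 2 * (C₁ - C₂) ^ 2
      = (C₁ * S₂ - C₂ * S₁) ^ 2) :
    ((⟨C₁, S₁⟩ : ℂ) + ⟨C₂, S₂⟩) ^ 2 - ⟨p, q⟩ - ⟨C₁, S₁⟩ ^ 2 * ⟨C₂, S₂⟩ ^ 2 * conj (⟨p, q⟩ : ℂ)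
      - (1 + (⟨p, q⟩ : ℂ) * conj (⟨p, q⟩ : ℂ)) * (⟨C₁, S₁⟩ * ⟨C₂, S₂⟩) = 0 := by
  have e₁ := mul_conj_mk_eq_one h₁
  have e₂ := mul_conj_mk_eq_one h₂
  have eF : (⟨p, q⟩ : ℂ) * conj (⟨p, q⟩ : ℂ) = 2 * (τ : ℂ) - 1 := by
    rw [mul_conj_mk]
    norm_cast
    linarith
  have cC₁ : (C₁ : ℂ) = ((⟨C₁, S₁⟩ : ℂ) + conj (⟨C₁, S₁⟩ : ℂ)) / 2 := by
    apply Complex.ext <;> simp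
  have cC₂ : (C₂ : ℂ) = ((⟨C₂, S₂⟩ : ℂ) + conj (⟨C₂, S₂⟩ : ℂ)) / 2 := by
    apply Complex.ext <;> simp
  have cp : (p : ℂ) = ((⟨p, q⟩ : ℂ) + conj (⟨p, q⟩ : ℂ)) / 2 := by
    apply Complex.ext <;> simp
  have cS₁ : (S₁ : ℂ) = -Complex.I * ((⟨C₁, S₁⟩ : ℂ) - conj (⟨C₁, S₁⟩ : ℂ)) / 2 := by
    apply Complex.ext <;> simp
  have cS₂ : (S₂ : ℂ) = -Complex.I * ((⟨C₂, S₂⟩ : ℂ) - conj (⟨C₂, S₂⟩ : ℂ)) / 2 := by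
    apply Complex.ext <;> simp
  have cq : (q : ℂ) = -Complex.I * ((⟨p, q⟩ : ℂ) - conj (⟨p, q⟩ : ℂ)) / 2 := by
    apply Complex.ext <;> simp
  have hh := congrArg (fun r : ℝ => (r : ℂ)) h
  push_cast at hh
  rw [cC₁, cC₂, cS₁, cS₂, cp, cq] at hh
  rw [eF]
  generalize (⟨C₁, S₁⟩ : ℂ) = u at *
  generalize (⟨C₂, S₂⟩ : ℂ) = v at *
  generalize (⟨p, q⟩ : ℂ) = F at *
  generalize conj F = G at *
  generalize conj u = u' at *
  generalize conj v = v' at *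
  have hI : Complex.I ^ 2 = -1 := Complex.I_sq
  have hreal : -((τ + (F + G) / 2) / 2 * ((u - u' - (v - v')) / 2) ^ 2)
      + (F - G) / 2 * ((u - u' - (v - v')) / 2) * ((u + u' - (v + v')) / 2)
      + (τ - (F + G) / 2) / 2 * ((u + u' - (v + v')) / 2) ^ 2
      = -(((u + u') / 2 * ((v - v') / 2) - (v + v') / 2 * ((u - u') / 2)) ^ 2) := by
    linear_combination hh - ((τ + (F + G) / 2) / 2 * ((u - u' - (v - v')) / 2) ^ 2
      - (F - G) / 2 * ((u - u' - (v - v')) / 2) * ((u + u' - (v + v')) / 2)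
      - ((u + u') / 2 * ((v - v') / 2) - (v + v') / 2 * ((u - u') / 2)) ^ 2) * hI
  have hu : u ≠ 0 := left_ne_zero_of_mul_eq_one e₁
  have hv : v ≠ 0 := left_ne_zero_of_mul_eq_one e₂
  rw [eq_inv_of_mul_eq_one_right e₁, eq_inv_of_mul_eq_one_right e₂] at hreal
  field_simp at hreal
  apply mul_left_cancel₀ (pow_ne_zero 2 (sub_ne_zero.mpr hne))
  linear_combination hreal / 4

/-- A line through two distinct points which meets an axis-parallel ellipse exactly once satisfies
the dual equation of the ellipse. -/
lemma dual_equation_of_isTangentLine {m n : ℝ} (hm : 0 < m) (hn : 0 < n) {A B : Pt} (hAB : A ≠ B)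
    (h : IsTangentLine (sideline A B) {P : Pt | (P 0) ^ 2 / m ^ 2 + (P 1) ^ 2 / n ^ 2 = 1}) :
    m ^ 2 * (A 1 - B 1) ^ 2 + n ^ 2 * (A 0 - B 0) ^ 2 = (A 0 * B 1 - B 0 * A 1) ^ 2 := by
  obtain ⟨Q, ⟨⟨t, rfl⟩, hQ⟩, huniq⟩ := h
  have hd : B - A ≠ 0 := sub_ne_zero.mpr hAB.symm
  set α := n ^ 2 * (B 0 - A 0) ^ 2 + m ^ 2 * (B 1 - A 1) ^ 2 with hα
  set β := n ^ 2 * A 0 * (B 0 - A 0) + m ^ 2 * A 1 * (B 1 - A 1) with hβ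
  have key : ∀ s : ℝ, (A + s • (B - A) ∈
      {P : Pt | (P 0) ^ 2 / m ^ 2 + (P 1) ^ 2 / n ^ 2 = 1}) ↔
      α * s ^ 2 + 2 * β * s + (n ^ 2 * A 0 ^ 2 + m ^ 2 * A 1 ^ 2 - m ^ 2 * n ^ 2) = 0 := by
    intro s
    simp only [Set.mem_ofPred_eq, PiLp.add_apply, PiLp.smul_apply, PiLp.sub_apply, smul_eq_mul]
    field_simp
    rw [hα, hβ]
    constructor <;> intro h <;> linear_combination h
  have hα0 : α ≠ 0 := by
    intro h0
    apply hd
    have h1 : n ^ 2 * (B 0 - A 0) ^ 2 = 0 := by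
      nlinarith [mul_nonneg (sq_nonneg n) (sq_nonneg (B 0 - A 0)),
        mul_nonneg (sq_nonneg m) (sq_nonneg (B 1 - A 1))]
    have h2 : m ^ 2 * (B 1 - A 1) ^ 2 = 0 := by linarith
    ext i
    fin_cases i
    · simpa [hn.ne'] using h1
    · simpa [hm.ne'] using h2
  have ht := (key t).1 hQ
  have ht' : α * (-2 * β / α - t) ^ 2 + 2 * β * (-2 * β / α - t)
      + (n ^ 2 * A 0 ^ 2 + m ^ 2 * A 1 ^ 2 - m ^ 2 * n ^ 2) = 0 := by
    rw [← ht]; field_simp; ring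
  have heq := huniq _ ⟨⟨_, rfl⟩, (key _).2 ht'⟩
  have hs : -2 * β / α - t = t := smul_left_injective ℝ hd (add_left_cancel heq)
  have hβt : β = -α * t := by
    field_simp at hs
    linarith
  have hdisc : β ^ 2 = α * (n ^ 2 * A 0 ^ 2 + m ^ 2 * A 1 ^ 2 - m ^ 2 * n ^ 2) := by
    linear_combination (β - α * t) * hβt - α * ht + 2 * α * t * hβt
  have hmn : m ^ 2 * n ^ 2 ≠ 0 := by positivity
  apply mul_left_cancel₀ hmn
  rw [hα, hβ] at hdisc
  linear_combination hdisc

/-- Three affinely independent points of the plane span a triangle of nonzero area. -/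
lemma area_ne_zero_of_affineIndependent {P₁ P₂ P₃ : Pt}
    (h : AffineIndependent ℝ ![P₁, P₂, P₃]) :
    (P₂ 0 - P₁ 0) * (P₃ 1 - P₁ 1) - (P₃ 0 - P₁ 0) * (P₂ 1 - P₁ 1) ≠ 0 := by
  intro h0
  rw [affineIndependent_iff] at h
  have key : ∀ w : Fin 3 → ℝ, w 0 + w 1 + w 2 = 0 →
      w 0 * P₁ 0 + w 1 * P₂ 0 + w 2 * P₃ 0 = 0 →
      w 0 * P₁ 1 + w 1 * P₂ 1 + w 2 * P₃ 1 = 0 → ∀ i, w i = 0 := by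
    intro w h1 h2 h3 i
    refine h Finset.univ w (by simpa [Fin.sum_univ_three] using h1) ?_ i (Finset.mem_univ i)
    ext j
    fin_cases j
    · simpa [Fin.sum_univ_three] using h2
    · simpa [Fin.sum_univ_three] using h3
  have ky := key ![P₂ 1 - P₃ 1, P₃ 1 - P₁ 1, P₁ 1 - P₂ 1] (by simp)
    (by simp; linear_combination h0) (by simp; ring)
  have kx := key ![P₂ 0 - P₃ 0, P₃ 0 - P₁ 0, P₁ 0 - P₂ 0] (by simp)
    (by simp; ring) (by simp; linear_combination -h0)
  have y := ky 2
  have x := kx 2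
  simp at x y
  have := key ![1, -1, 0] (by simp) (by simp; linarith) (by simp; linarith) 0
  simp at this

/-- Parametrization of the tilted ellipse by the unit circle. -/
lemma exists_unit_circle_param {a b c x y : ℝ} (ha : a ≠ 0) (hb : b ≠ 0)
    (h : (b ^ 2 + c ^ 2) * x ^ 2 - 2 * a * c * x * y + a ^ 2 * y ^ 2 = a ^ 2 * b ^ 2) :
    ∃ C S : ℝ, C ^ 2 + S ^ 2 = 1 ∧ x = a * C ∧ y = c * C + b * S := by
  refine ⟨x / a, (a * y - c * x) / (a * b), ?_, ?_, ?_⟩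
  · field_simp
    linear_combination h
  · field_simp
  · field_simp
    ring

/-- Two of the sides of a triangle inscribed in the unit circle being tangent to the ellipse with
squared focus `p + q i` determines the second elementary symmetric function of the vertices, and
the distance from the origin to their sum. -/
lemma symmetric_functions_of_chords_tangent {C₁ S₁ C₂ S₂ C₃ S₃ p q τ : ℝ}
    (h₁ : C₁ ^ 2 + S₁ ^ 2 = 1) (h₂ : C₂ ^ 2 + S₂ ^ 2 = 1) (h₃ : C₃ ^ 2 + S₃ ^ 2 = 1)
    (h₁₂ : (⟨C₁, S₁⟩ : ℂ) ≠ ⟨C₂, S₂⟩) (h₂₃ : (⟨C₂, S₂⟩ : ℂ) ≠ ⟨C₃, S₃⟩)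
    (h₁₃ : (⟨C₁, S₁⟩ : ℂ) ≠ ⟨C₃, S₃⟩)
    (hτ : 2 * τ = 1 + (p ^ 2 + q ^ 2)) (hpq : p ^ 2 + q ^ 2 ≠ 1)
    (t₁₂ : (τ + p) / 2 * (S₁ - S₂) ^ 2 - q * (S₁ - S₂) * (C₁ - C₂) + (τ - p) / 2 * (C₁ - C₂) ^ 2
      = (C₁ * S₂ - C₂ * S₁) ^ 2)
    (t₁₃ : (τ + p) / 2 * (S₁ - S₃) ^ 2 - q * (S₁ - S₃) * (C₁ - C₃) + (τ - p) / 2 * (C₁ - C₃) ^ 2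
      = (C₁ * S₃ - C₃ * S₁) ^ 2) :
    (C₁ * C₂ - S₁ * S₂) + (C₁ * C₃ - S₁ * S₃) + (C₂ * C₃ - S₂ * S₃) = -p ∧
    (C₁ * S₂ + S₁ * C₂) + (C₁ * S₃ + S₁ * C₃) + (C₂ * S₃ + S₂ * C₃) = -q ∧
    (C₁ + C₂ + C₃) ^ 2 + (S₁ + S₂ + S₃) ^ 2 = p ^ 2 + q ^ 2 := by
  have hF : (⟨p, q⟩ : ℂ) * conj (⟨p, q⟩ : ℂ) ≠ 1 := by
    rw [mul_conj_mk]
    exact_mod_cast hpq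
  have e := sum_mul_eq_neg_of_chords_tangent (mul_conj_mk_eq_one h₁) hF h₂₃
    (chord_tangent_complex h₁ h₂ h₁₂ hτ t₁₂) (chord_tangent_complex h₁ h₃ h₁₃ hτ t₁₃)
  have hre := congrArg Complex.re e
  have him := congrArg Complex.im e
  simp only [Complex.add_re, Complex.mul_re, Complex.add_im, Complex.mul_im, Complex.neg_re,
    Complex.neg_im] at hre him
  refine ⟨by linarith, by linarith, ?_⟩
  have m₁ := mul_conj_mk_eq_one h₁
  have m₂ := mul_conj_mk_eq_one h₂
  have m₃ := mul_conj_mk_eq_one h₃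
  have hs : ((⟨C₁ + C₂ + C₃, S₁ + S₂ + S₃⟩ : ℂ)) = ⟨C₁, S₁⟩ + ⟨C₂, S₂⟩ + ⟨C₃, S₃⟩ := by
    apply Complex.ext <;> simp
  have e' := congrArg conj e
  have hn := mul_conj_mk (C₁ + C₂ + C₃) (S₁ + S₂ + S₃)
  have hn' := mul_conj_mk p q
  rw [hs] at hn
  simp only [map_add, map_mul, map_neg] at hn e'
  have hcast : (((C₁ + C₂ + C₃) ^ 2 + (S₁ + S₂ + S₃) ^ 2 : ℝ) : ℂ) = ((p ^ 2 + q ^ 2 : ℝ) : ℂ) := by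
    rw [← hn, ← hn']
    generalize (⟨C₁, S₁⟩ : ℂ) = u at *
    generalize (⟨C₂, S₂⟩ : ℂ) = v at *
    generalize (⟨C₃, S₃⟩ : ℂ) = w at *
    generalize (⟨p, q⟩ : ℂ) = F at *
    generalize conj u = u' at *
    generalize conj v = v' at *
    generalize conj w = w' at *
    generalize conj F = G at *
    obtain rfl : F = -(u * v + u * w + v * w) := by linear_combination e
    obtain rfl : G = -(u' * v' + u' * w' + v' * w') := by linear_combination e'
    have k₁ : u * v * w * (u' * v' + u' * w' + v' * w') = u + v + w := by
      linear_combination (w * v * v' + v * w * w') * m₁ + (w + u * w * w') * m₂ + (u + v) * m₃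
    have k₂ : u' * v' * w' * (u * v + u * w + v * w) = u' + v' + w' := by
      linear_combination (w' * v * v' + v' * w * w') * m₁ + (w' + u' * w * w') * m₂ + (u' + v') * m₃
    rw [← k₁, ← k₂]
    linear_combination (u * v + u * w + v * w) * (u' * v' + u' * w' + v' * w') *
      (v * v' * w * w' * m₁ + w * w' * m₂ + m₃)
  exact_mod_cast hcast

/-- Real form of `const_eq_of_three_zeros`. -/
lemma const_eq_of_three_zeros_real {C₁ S₁ C₂ S₂ C₃ S₃ A B M N k : ℝ}
    (h₁ : C₁ ^ 2 + S₁ ^ 2 = 1) (h₂ : C₂ ^ 2 + S₂ ^ 2 = 1) (h₃ : C₃ ^ 2 + S₃ ^ 2 = 1)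
    (h₁₂ : (⟨C₁, S₁⟩ : ℂ) ≠ ⟨C₂, S₂⟩) (h₂₃ : (⟨C₂, S₂⟩ : ℂ) ≠ ⟨C₃, S₃⟩)
    (h₃₁ : (⟨C₃, S₃⟩ : ℂ) ≠ ⟨C₁, S₁⟩)
    (e₁ : A * (C₁ ^ 2 - S₁ ^ 2) + B * (2 * C₁ * S₁) + M * C₁ + N * S₁ + k = 0)
    (e₂ : A * (C₂ ^ 2 - S₂ ^ 2) + B * (2 * C₂ * S₂) + M * C₂ + N * S₂ + k = 0)
    (e₃ : A * (C₃ ^ 2 - S₃ ^ 2) + B * (2 * C₃ * S₃) + M * C₃ + N * S₃ + k = 0) :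
    k = A * ((C₁ * C₂ - S₁ * S₂) + (C₁ * C₃ - S₁ * S₃) + (C₂ * C₃ - S₂ * S₃))
      + B * ((C₁ * S₂ + S₁ * C₂) + (C₁ * S₃ + S₁ * C₃) + (C₂ * S₃ + S₂ * C₃)) := by
  have key : ∀ C S : ℝ, A * (C ^ 2 - S ^ 2) + B * (2 * C * S) + M * C + N * S + k = 0 →
      (⟨A / 2, -B / 2⟩ : ℂ) * ⟨C, S⟩ ^ 2 + ⟨A / 2, B / 2⟩ * conj (⟨C, S⟩ : ℂ) ^ 2
        + ⟨M / 2, -N / 2⟩ * ⟨C, S⟩ + ⟨M / 2, N / 2⟩ * conj (⟨C, S⟩ : ℂ) + (k : ℂ) = 0 := by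
    intro C S h
    apply Complex.ext
    · simp [pow_two]
      linear_combination h
    · simp [pow_two]
      ring
  have := congrArg Complex.re (const_eq_of_three_zeros (mul_conj_mk_eq_one h₁)
    (mul_conj_mk_eq_one h₂) (mul_conj_mk_eq_one h₃) h₁₂ h₂₃ h₃₁ (key _ _ e₁) (key _ _ e₂)
    (key _ _ e₃))
  simp at this
  linear_combination this

lemma dist_sq_eq (A B : Pt) : dist A B ^ 2 = (A 0 - B 0) ^ 2 + (A 1 - B 1) ^ 2 := by
  rw [EuclideanSpace.dist_sq_eq, Fin.sum_univ_two, Real.dist_eq, Real.dist_eq, sq_abs, sq_abs]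

lemma inner_eq (A B : Pt) : ⟪A, B⟫ = A 0 * B 0 + A 1 * B 1 := by
  simp [PiLp.inner_apply, Fin.sum_univ_two, mul_comm]

/-- The dual equation of the inner ellipse, transported to the chord of the unit circle which the
affine parametrization maps to a side. -/
lemma unit_chord_tangent {a b c m n C₁ S₁ C₂ S₂ : ℝ} (ha : a ≠ 0) (hb : b ≠ 0)
    (h : m ^ 2 * (c * C₁ + b * S₁ - (c * C₂ + b * S₂)) ^ 2 + n ^ 2 * (a * C₁ - a * C₂) ^ 2
      = (a * C₁ * (c * C₂ + b * S₂) - a * C₂ * (c * C₁ + b * S₁)) ^ 2) :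
    ((b ^ 2 * m ^ 2 + c ^ 2 * m ^ 2 + a ^ 2 * n ^ 2) / (a ^ 2 * b ^ 2)
        + (b ^ 2 * m ^ 2 - c ^ 2 * m ^ 2 - a ^ 2 * n ^ 2) / (a ^ 2 * b ^ 2)) / 2 * (S₁ - S₂) ^ 2
      - -(2 * b * c * m ^ 2) / (a ^ 2 * b ^ 2) * (S₁ - S₂) * (C₁ - C₂)
      + ((b ^ 2 * m ^ 2 + c ^ 2 * m ^ 2 + a ^ 2 * n ^ 2) / (a ^ 2 * b ^ 2)
        - (b ^ 2 * m ^ 2 - c ^ 2 * m ^ 2 - a ^ 2 * n ^ 2) / (a ^ 2 * b ^ 2)) / 2 * (C₁ - C₂) ^ 2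
      = (C₁ * S₂ - C₂ * S₁) ^ 2 := by
  field_simp
  linear_combination 2 * h

/-- Theorem: invariant power of the center, concentric unaligned pair.
For the concentric pair consisting of the tilted outer ellipse
`(b² + c²)x² − 2ac·xy + a²y² = a²b²` and the axis-aligned inner ellipse with semi-axes
`a_c ≥ b_c > 0` satisfying the Cayley condition, every Poncelet 3-periodic has
power of the origin wrt the circumcircle equal to
`−(a·b_c/(b·a_c))·(b² + a_c² − b_c²) − (a_c² − b_c²)` and wrt the nine-point circle equal to
`−(a·b_c/(2·b·a_c))·(b² + a_c² − b_c²) + b_c²`. -/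
theorem power_center_concentric_unaligned
    (a b c a_c b_c : ℝ)
    (hab : a > b) (hb : b > 0)
    (hc : c ^ 2 = a ^ 2 - b ^ 2)
    (hcc : a_c ≥ b_c) (hbc : b_c > 0)
    (hcayley : -c ^ 2 * a_c ^ 2 +
      (a * b + a * b_c + a_c * b) * (a * b - a * b_c - a_c * b) = 0)
    (E E_c : Set Pt)
    (hE : E = {P : Pt | (b ^ 2 + c ^ 2) * (P 0) ^ 2 - 2 * a * c * (P 0) * (P 1)
      + a ^ 2 * (P 1) ^ 2 = a ^ 2 * b ^ 2})
    (hEc : E_c = {P : Pt | (P 0) ^ 2 / a_c ^ 2 + (P 1) ^ 2 / b_c ^ 2 = 1})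
    (P₁ P₂ P₃ : Pt)
    (hP₁ : P₁ ∈ E) (hP₂ : P₂ ∈ E) (hP₃ : P₃ ∈ E)
    (hnd : AffineIndependent ℝ ![P₁, P₂, P₃])
    (hcirc : Circumscribes P₁ P₂ P₃ E_c)
    -- circumcenter `O` and circumradius `R`
    (O : Pt) (R : ℝ)
    (hO₁ : dist O P₁ = R) (hO₂ : dist O P₂ = R) (hO₃ : dist O P₃ = R)
    -- orthocenter `H`: common point of the altitudes
    (H : Pt)
    (hH₁ : ⟪H - P₁, P₂ - P₃⟫ = 0)
    (hH₂ : ⟪H - P₂, P₃ - P₁⟫ = 0)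
    (hH₃ : ⟪H - P₃, P₁ - P₂⟫ = 0) :
    circlePower 0 O R =
      -(a * b_c / (b * a_c)) * (b ^ 2 + a_c ^ 2 - b_c ^ 2) - (a_c ^ 2 - b_c ^ 2) ∧
    circlePower 0 (midpoint ℝ O H) (R / 2) =
      -(a * b_c / (2 * b * a_c)) * (b ^ 2 + a_c ^ 2 - b_c ^ 2) + b_c ^ 2 := by
  have hb0 : b ≠ 0 := hb.ne'
  have ha : 0 < a := hb.trans hab
  have ha0 : a ≠ 0 := ha.ne'
  have hm : 0 < a_c := hbc.trans_le hcc
  subst hE hEc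
  obtain ⟨ht₁₂, -, ht₃₁, -⟩ := hcirc
  have hD := area_ne_zero_of_affineIndependent hnd
  have hne₁₂ : P₁ ≠ P₂ := by rintro rfl; apply hD; ring
  have hne₃₁ : P₃ ≠ P₁ := by rintro rfl; apply hD; ring
  have d₁₂ := dual_equation_of_isTangentLine hm hbc hne₁₂ ht₁₂
  have d₃₁ := dual_equation_of_isTangentLine hm hbc hne₃₁ ht₃₁
  obtain ⟨C₁, S₁, u₁, x₁, y₁⟩ := exists_unit_circle_param ha0 hb0 hP₁
  obtain ⟨C₂, S₂, u₂, x₂, y₂⟩ := exists_unit_circle_param ha0 hb0 hP₂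
  obtain ⟨C₃, S₃, u₃, x₃, y₃⟩ := exists_unit_circle_param ha0 hb0 hP₃
  have hO₁' := dist_sq_eq O P₁
  have hO₂' := dist_sq_eq O P₂
  have hO₃' := dist_sq_eq O P₃
  rw [inner_eq] at hH₁ hH₂ hH₃
  simp only [PiLp.sub_apply] at hH₁ hH₂ hH₃
  rw [hO₁, x₁, y₁] at hO₁'
  rw [hO₂, x₂, y₂] at hO₂'
  rw [hO₃, x₃, y₃] at hO₃'
  rw [x₁, y₁, x₂, y₂] at d₁₂
  rw [x₁, y₁, x₃, y₃] at d₃₁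
  rw [x₁, y₁, x₂, y₂, x₃, y₃] at hD hH₁ hH₂ hH₃
  have z₁₂ : (⟨C₁, S₁⟩ : ℂ) ≠ ⟨C₂, S₂⟩ := by
    intro h
    obtain ⟨rfl, rfl⟩ := Complex.mk.inj h
    apply hD; ring
  have z₂₃ : (⟨C₂, S₂⟩ : ℂ) ≠ ⟨C₃, S₃⟩ := by
    intro h
    obtain ⟨rfl, rfl⟩ := Complex.mk.inj h
    apply hD; ring
  have z₃₁ : (⟨C₃, S₃⟩ : ℂ) ≠ ⟨C₁, S₁⟩ := by
    intro h
    obtain ⟨rfl, rfl⟩ := Complex.mk.inj h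
    apply hD; ring
  have t₁₂ := unit_chord_tangent ha0 hb0 d₁₂
  have t₁₃ := unit_chord_tangent (c := c) (m := a_c) (n := b_c) (C₁ := C₁) (S₁ := S₁)
    (C₂ := C₃) (S₂ := S₃) ha0 hb0 (by linear_combination d₃₁)
  have hcayley' : (b ^ 2 * a_c ^ 2 + c ^ 2 * a_c ^ 2 + a ^ 2 * b_c ^ 2)
      + 2 * (a * b * a_c * b_c) = a ^ 2 * b ^ 2 := by
    linear_combination -hcayley
  have hK : a * (a_c ^ 2 + b_c ^ 2) + 2 * (b * a_c * b_c) = a * b ^ 2 := by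
    apply mul_left_cancel₀ ha0
    linear_combination hcayley' - a_c ^ 2 * hc
  have hnorm : ((b ^ 2 * a_c ^ 2 - c ^ 2 * a_c ^ 2 - a ^ 2 * b_c ^ 2) / (a ^ 2 * b ^ 2)) ^ 2
      + (-(2 * b * c * a_c ^ 2) / (a ^ 2 * b ^ 2)) ^ 2 = 1 - 4 * (a_c * b_c) / (a * b) := by
    field_simp
    linear_combination (b ^ 2 * a_c ^ 2 + c ^ 2 * a_c ^ 2 + a ^ 2 * b_c ^ 2
      - 2 * (a * b * a_c * b_c) + a ^ 2 * b ^ 2) * hcayley'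
  have hτ : 2 * ((b ^ 2 * a_c ^ 2 + c ^ 2 * a_c ^ 2 + a ^ 2 * b_c ^ 2) / (a ^ 2 * b ^ 2))
      = 1 + (((b ^ 2 * a_c ^ 2 - c ^ 2 * a_c ^ 2 - a ^ 2 * b_c ^ 2) / (a ^ 2 * b ^ 2)) ^ 2
      + (-(2 * b * c * a_c ^ 2) / (a ^ 2 * b ^ 2)) ^ 2) := by
    rw [hnorm]
    field_simp
    linear_combination 2 * hcayley'
  have hlt : ((b ^ 2 * a_c ^ 2 - c ^ 2 * a_c ^ 2 - a ^ 2 * b_c ^ 2) / (a ^ 2 * b ^ 2)) ^ 2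
      + (-(2 * b * c * a_c ^ 2) / (a ^ 2 * b ^ 2)) ^ 2 ≠ 1 := by
    rw [hnorm]
    have : 0 < 4 * (a_c * b_c) / (a * b) := by positivity
    linarith
  obtain ⟨sre, sim, snorm⟩ := symmetric_functions_of_chords_tangent u₁ u₂ u₃ z₁₂ z₂₃ z₃₁.symm hτ
    hlt t₁₂ t₁₃
  rw [hnorm] at snorm
  have circle_eq : ∀ C S : ℝ, C ^ 2 + S ^ 2 = 1 →
      R ^ 2 = (O 0 - a * C) ^ 2 + (O 1 - (c * C + b * S)) ^ 2 →
      c ^ 2 * (C ^ 2 - S ^ 2) + (b * c) * (2 * C * S) + (-(2 * (a * O 0 + c * O 1))) * C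
        + (-(2 * b * O 1)) * S + (a ^ 2 + (O 0 ^ 2 + O 1 ^ 2 - R ^ 2)) = 0 := by
    intro C S h hR
    linear_combination -hR - a ^ 2 * h - S ^ 2 * hc
  have q₁ := circle_eq _ _ u₁ hO₁'
  have q₂ := circle_eq _ _ u₂ hO₂'
  have q₃ := circle_eq _ _ u₃ hO₃'
  have hw := const_eq_of_three_zeros_real u₁ u₂ u₃ z₁₂ z₂₃ z₃₁ q₁ q₂ q₃
  have hpow : O 0 ^ 2 + O 1 ^ 2 - R ^ 2 =
      -(a * b_c / (b * a_c)) * (b ^ 2 + a_c ^ 2 - b_c ^ 2) - (a_c ^ 2 - b_c ^ 2) := by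
    rw [sre, sim] at hw
    have hw' : O 0 ^ 2 + O 1 ^ 2 - R ^ 2
        = -a ^ 2 + c ^ 2 * (a_c ^ 2 + b_c ^ 2) / b ^ 2 := by
      rw [eq_sub_of_add_eq' hw]
      field_simp
      linear_combination (c ^ 2 * a_c ^ 2) * hc
    rw [hw']
    field_simp
    linear_combination (a * a_c - b * b_c) * hK + a_c * (a_c ^ 2 + b_c ^ 2) * hc
  have hHO : H 0 = a * (C₁ + C₂ + C₃) - 2 * O 0 ∧
      H 1 = c * (C₁ + C₂ + C₃) + b * (S₁ + S₂ + S₃) - 2 * O 1 := by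
    have v₁ : (H 0 + 2 * O 0 - a * (C₁ + C₂ + C₃)) * (a * C₂ - a * C₃)
        + (H 1 + 2 * O 1 - (c * (C₁ + C₂ + C₃) + b * (S₁ + S₂ + S₃)))
          * (c * C₂ + b * S₂ - (c * C₃ + b * S₃)) = 0 := by
      linear_combination hH₁ + hO₂' - hO₃'
    have v₂ : (H 0 + 2 * O 0 - a * (C₁ + C₂ + C₃)) * (a * C₃ - a * C₁)
        + (H 1 + 2 * O 1 - (c * (C₁ + C₂ + C₃) + b * (S₁ + S₂ + S₃)))
          * (c * C₃ + b * S₃ - (c * C₁ + b * S₁)) = 0 := by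
      linear_combination hH₂ + hO₃' - hO₁'
    constructor
    · apply mul_left_cancel₀ hD
      linear_combination (c * C₃ + b * S₃ - (c * C₁ + b * S₁)) * v₁
        - (c * C₂ + b * S₂ - (c * C₃ + b * S₃)) * v₂
    · apply mul_left_cancel₀ hD
      linear_combination (a * C₂ - a * C₃) * v₂ - (a * C₃ - a * C₁) * v₁
  obtain ⟨hH0, hH1⟩ := hHO
  refine ⟨?_, ?_⟩
  · rw [circlePower, dist_sq_eq, ← hpow]
    simp
  · have hmid : circlePower 0 (midpoint ℝ O H) (R / 2) =
        ((O 0 + H 0) / 2) ^ 2 + ((O 1 + H 1) / 2) ^ 2 - R ^ 2 / 4 := by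
      rw [circlePower, dist_sq_eq, midpoint_eq_smul_add]
      simp
      ring
    have hnine : ((O 0 + H 0) / 2) ^ 2 + ((O 1 + H 1) / 2) ^ 2 - R ^ 2 / 4
        = -(a * a_c * b_c / b) := by
      rw [hH0, hH1]
      have hn' : -(a * a_c * b_c / b)
        = a ^ 2 * ((C₁ + C₂ + C₃) ^ 2 + (S₁ + S₂ + S₃) ^ 2) / 4 - a ^ 2 / 4 := by
        rw [snorm]
        field_simp
        ring
      rw [hn']
      linear_combination (q₁ + q₂ + q₃) / 4 - hw / 2 + (S₁ + S₂ + S₃) ^ 2 * hc / 4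
    rw [hmid, hnine]
    field_simp
    linear_combination -hK
end
end

section
/- Let a > b > 0, c² = a² − b², and a_c, b_c > 0 with a_c < a, b_c < b satisfy a_c/a + b_c/b = 1. Let E = {(x,y) ∈ ℝ² : x²/a² + y²/b² = 1} and E_c = {(x,y) ∈ ℝ² : x²/a_c² + y²/b_c² = 1}. Then for every triangle with vertices on E that circumscribes E_c, the power of the origin with respect to the circumcircle equals −(a_c/a)·c² − b², and the power of the origin with respect to the nine-point circle equals −a_c·(a − a_c)·(a² + b²)/(2a²). -/
open scoped RealInnerProductSpace

noncomputable section

/-- A chord of the unit circle whose line is tangent to the ellipse with semiaxes `u`, `v`,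
`u + v = 1`, has endpoints that are conjugate up to sign for that pencil. -/
lemma chord_relation_of_discriminant_eq_zero {u v x₁ y₁ x₂ y₂ : ℝ} (huv : u + v = 1)
    (h₁ : x₁ ^ 2 + y₁ ^ 2 = 1) (h₂ : x₂ ^ 2 + y₂ ^ 2 = 1)
    (hne : x₁ ≠ x₂ ∨ y₁ ≠ y₂)
    (hdisc : u ^ 2 * (y₂ - y₁) ^ 2 + v ^ 2 * (x₂ - x₁) ^ 2 = (x₁ * y₂ - x₂ * y₁) ^ 2) :
    v * (x₁ * x₂) + u * (y₁ * y₂) = -(u * v) := by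
  have hd : 1 - (x₁ * x₂ + y₁ * y₂) ≠ 0 := by
    intro h
    have h0 : (x₁ - x₂) ^ 2 + (y₁ - y₂) ^ 2 = 0 := by linear_combination h₁ + h₂ + 2 * h
    have hx : x₁ - x₂ = 0 := by nlinarith [sq_nonneg (x₁ - x₂), sq_nonneg (y₁ - y₂)]
    have hy : y₁ - y₂ = 0 := by nlinarith [sq_nonneg (x₁ - x₂), sq_nonneg (y₁ - y₂)]
    rcases hne with hne | hne
    · exact hne (by linarith)
    · exact hne (by linarith)
  obtain rfl : v = 1 - u := by linarith
  have hdx : (x₂ - x₁) ^ 2 = (1 - (x₁ * x₂ + y₁ * y₂)) * (1 - (x₁ * x₂ - y₁ * y₂)) := by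
    grind
  have hdy : (y₂ - y₁) ^ 2 = (1 - (x₁ * x₂ + y₁ * y₂)) * (1 + (x₁ * x₂ - y₁ * y₂)) := by
    grind
  have hcr : (x₁ * y₂ - x₂ * y₁) ^ 2
      = (1 - (x₁ * x₂ + y₁ * y₂)) * (1 + (x₁ * x₂ + y₁ * y₂)) := by
    grind
  rw [hdx, hdy, hcr] at hdisc
  have := mul_left_cancel₀ hd (show (1 - (x₁ * x₂ + y₁ * y₂)) *
    (u ^ 2 * (1 + (x₁ * x₂ - y₁ * y₂)) + (1 - u) ^ 2 * (1 - (x₁ * x₂ - y₁ * y₂)))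
      = (1 - (x₁ * x₂ + y₁ * y₂)) * (1 + (x₁ * x₂ + y₁ * y₂)) by linear_combination hdisc)
  linear_combination -(1 / 2) * this

/-- If a sideline meets an axis-aligned ellipse exactly once, the corresponding quadratic
has vanishing discriminant. -/
lemma IsTangentLine.discriminant_eq_zero {p q : ℝ} (hp : p ≠ 0) (hq : q ≠ 0) {A B : Pt}
    (hAB : A ≠ B)
    (h : IsTangentLine (sideline A B) {P : Pt | (P 0) ^ 2 / p ^ 2 + (P 1) ^ 2 / q ^ 2 = 1}) :
    p ^ 2 * (B 1 - A 1) ^ 2 + q ^ 2 * (B 0 - A 0) ^ 2 = (A 0 * B 1 - B 0 * A 1) ^ 2 := by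
  have hne : A 0 ≠ B 0 ∨ A 1 ≠ B 1 := by
    by_contra! hcon
    exact hAB (by ext i; fin_cases i <;> simp [hcon.1, hcon.2])
  obtain ⟨Q, ⟨⟨t, rfl⟩, hQ⟩, huniq⟩ := h
  have hmem (s : ℝ) : A + s • (B - A) ∈ {P : Pt | (P 0) ^ 2 / p ^ 2 + (P 1) ^ 2 / q ^ 2 = 1} ↔
      q ^ 2 * (A 0 + s * (B 0 - A 0)) ^ 2 + p ^ 2 * (A 1 + s * (B 1 - A 1)) ^ 2
        = p ^ 2 * q ^ 2 := by
    simp only [Set.mem_ofPred_eq, PiLp.add_apply, PiLp.smul_apply, PiLp.sub_apply, smul_eq_mul]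
    field_simp
  set k := q ^ 2 * (B 0 - A 0) ^ 2 + p ^ 2 * (B 1 - A 1) ^ 2 with hk
  have hk0 : k ≠ 0 := by
    have : 0 < k := by
      rcases hne with hne | hne
      · have := sub_ne_zero.2 hne.symm
        positivity
      · have := sub_ne_zero.2 hne.symm
        positivity
    exact this.ne'
  set m := q ^ 2 * A 0 * (B 0 - A 0) + p ^ 2 * A 1 * (B 1 - A 1) with hm
  have hroot := (hmem t).1 hQ
  set s := -(2 * m) / k - t with hs
  have hsk : k * (s + t) = -(2 * m) := by rw [hs]; field_simp; ring
  have hroot' : q ^ 2 * (A 0 + s * (B 0 - A 0)) ^ 2 + p ^ 2 * (A 1 + s * (B 1 - A 1)) ^ 2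
        = p ^ 2 * q ^ 2 := by
    rw [hk, hm] at hsk
    linear_combination hroot + (s - t) * hsk
  have heq := huniq _ ⟨⟨s, rfl⟩, (hmem s).2 hroot'⟩
  have h0 := congrArg (fun P : Pt => P 0) heq
  have h1 := congrArg (fun P : Pt => P 1) heq
  simp only [PiLp.add_apply, PiLp.smul_apply, PiLp.sub_apply, smul_eq_mul] at h0 h1
  have hst : s = t := by
    rcases hne with hne | hne
    · exact mul_right_cancel₀ (sub_ne_zero.2 hne.symm) (by linarith)
    · exact mul_right_cancel₀ (sub_ne_zero.2 hne.symm) (by linarith)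
  rw [hst] at hsk
  have hkt : k * t = -m := by linarith
  have hdisc : m ^ 2 = k * (q ^ 2 * A 0 ^ 2 + p ^ 2 * A 1 ^ 2 - p ^ 2 * q ^ 2) := by
    have : k * t ^ 2 + 2 * m * t + (q ^ 2 * A 0 ^ 2 + p ^ 2 * A 1 ^ 2 - p ^ 2 * q ^ 2) = 0 := by
      rw [hk, hm]; linear_combination hroot
    linear_combination (-k) * this + (k * t + m) * hkt
  have hpq : p ^ 2 * q ^ 2 ≠ 0 := by positivity
  refine mul_left_cancel₀ hpq ?_
  rw [hk, hm] at hdisc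
  linear_combination hdisc

/-- The second elementary symmetric function of three points whose pairs satisfy the
symmetric `(2,2)`-correspondence of the Poncelet triangles. -/
lemma esymm_two_of_correspondence {K : Type*} [Field K] {w z₁ z₂ z₃ : K}
    (h23 : z₂ ≠ z₃) (hw : w * z₁ ^ 2 - 1 ≠ 0)
    (h₁₂ : w * (z₁ ^ 2 * z₂ ^ 2 + 1) - z₁ ^ 2 - z₂ ^ 2 = (1 - w ^ 2) * (z₁ * z₂))
    (h₁₃ : w * (z₁ ^ 2 * z₃ ^ 2 + 1) - z₁ ^ 2 - z₃ ^ 2 = (1 - w ^ 2) * (z₁ * z₃)) :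
    z₁ * z₂ + z₁ * z₃ + z₂ * z₃ = -w := by
  have hsum : (w * z₁ ^ 2 - 1) * (z₂ + z₃) = (1 - w ^ 2) * z₁ :=
    mul_left_cancel₀ (sub_ne_zero.2 h23) (by linear_combination h₁₂ - h₁₃)
  refine mul_left_cancel₀ hw ?_
  linear_combination (z₁ + z₂) * hsum - h₁₂

/-- Real form of `esymm_two_of_correspondence` for points of the unit circle. -/
lemma esymm_two_of_chord_relations {u v x₁ y₁ x₂ y₂ x₃ y₃ : ℝ} (hu : 0 < u) (hv : 0 < v)
    (huv : u + v = 1)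
    (h₁ : x₁ ^ 2 + y₁ ^ 2 = 1) (h₂ : x₂ ^ 2 + y₂ ^ 2 = 1) (h₃ : x₃ ^ 2 + y₃ ^ 2 = 1)
    (hne : x₂ ≠ x₃ ∨ y₂ ≠ y₃)
    (h₁₂ : v * (x₁ * x₂) + u * (y₁ * y₂) = -(u * v))
    (h₁₃ : v * (x₁ * x₃) + u * (y₁ * y₃) = -(u * v)) :
    x₁ * x₂ + x₁ * x₃ + x₂ * x₃ - (y₁ * y₂ + y₁ * y₃ + y₂ * y₃) = v - u ∧
      x₁ * y₂ + x₂ * y₁ + x₁ * y₃ + x₃ * y₁ + x₂ * y₃ + x₃ * y₂ = 0 := by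
  have key (x y x' y' : ℝ) (h : x ^ 2 + y ^ 2 = 1) (h' : x' ^ 2 + y' ^ 2 = 1)
      (hr : v * (x * x') + u * (y * y') = -(u * v)) :
      ((u - v : ℝ) : ℂ) * ((⟨x, y⟩ : ℂ) ^ 2 * (⟨x', y'⟩ : ℂ) ^ 2 + 1) - (⟨x, y⟩ : ℂ) ^ 2
        - (⟨x', y'⟩ : ℂ) ^ 2 = (1 - ((u - v : ℝ) : ℂ) ^ 2) * ((⟨x, y⟩ : ℂ) * ⟨x', y'⟩) := by
    obtain rfl : v = 1 - u := by linarith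
    apply Complex.ext
    · simp [pow_two]
      grind
    · simp [pow_two]
      grind
  have hz : (⟨x₂, y₂⟩ : ℂ) ≠ ⟨x₃, y₃⟩ := by
    simp only [ne_eq, Complex.mk.injEq]
    tauto
  have hw : ((u - v : ℝ) : ℂ) * (⟨x₁, y₁⟩ : ℂ) ^ 2 - 1 ≠ 0 := by
    intro h
    have hre := congrArg Complex.re h
    simp [pow_two] at hre
    have h0 : v * x₁ ^ 2 + u * y₁ ^ 2 = 0 := by
      linear_combination (-(1 / 2)) * hre + ((u + v) / 2) * h₁ + (1 / 2) * huv
    have hx : v * x₁ ^ 2 = 0 := by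
      nlinarith [mul_nonneg hv.le (sq_nonneg x₁), mul_nonneg hu.le (sq_nonneg y₁)]
    have hy : u * y₁ ^ 2 = 0 := by linarith
    have hx' := (mul_eq_zero.1 hx).resolve_left hv.ne'
    have hy' := (mul_eq_zero.1 hy).resolve_left hu.ne'
    linarith
  have h := esymm_two_of_correspondence hz hw (key _ _ _ _ h₁ h₂ h₁₂) (key _ _ _ _ h₁ h₃ h₁₃)
  have hre := congrArg Complex.re h
  have him := congrArg Complex.im h
  simp at hre him
  exact ⟨by linarith, by linarith⟩

/-- On a triple of the unit circle with second elementary symmetric function `v - u`,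
the function `x ^ 2 - u` is a homogeneous linear form. -/
lemma sq_sub_eq_linear_of_esymm_two {u v x₁ y₁ x₂ y₂ x₃ y₃ : ℝ} (huv : u + v = 1)
    (h₁ : x₁ ^ 2 + y₁ ^ 2 = 1) (h₂ : x₂ ^ 2 + y₂ ^ 2 = 1) (h₃ : x₃ ^ 2 + y₃ ^ 2 = 1)
    (hre : x₁ * x₂ + x₁ * x₃ + x₂ * x₃ - (y₁ * y₂ + y₁ * y₃ + y₂ * y₃) = v - u)
    (him : x₁ * y₂ + x₂ * y₁ + x₁ * y₃ + x₃ * y₁ + x₂ * y₃ + x₃ * y₂ = 0) :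
    x₁ ^ 2 - u = v * (x₁ * x₂ * x₃ - x₁ * y₂ * y₃ - y₁ * x₂ * y₃ - y₁ * y₂ * x₃) * x₁
      + u * (x₁ * x₂ * y₃ + x₁ * y₂ * x₃ + y₁ * x₂ * x₃ - y₁ * y₂ * y₃) * y₁ := by
  set r := x₁ * x₂ * x₃ - x₁ * y₂ * y₃ - y₁ * x₂ * y₃ - y₁ * y₂ * x₃ with hr
  set s := x₁ * x₂ * y₃ + x₁ * y₂ * x₃ + y₁ * x₂ * x₃ - y₁ * y₂ * y₃ with hs
  have hsx : x₁ + x₂ + x₃ = (v - u) * r := by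
    rw [← hre, hr]; grind
  have hsy : y₁ + y₂ + y₃ = (v - u) * s := by
    rw [← hre, hs]; grind
  have hp : x₂ * x₃ - y₂ * y₃ = r * x₁ + s * y₁ := by
    rw [hr, hs]; linear_combination (-(x₂ * x₃ - y₂ * y₃)) * h₁
  obtain rfl : v = 1 - u := by linarith
  linear_combination (1 / 2) * (x₁ * hsx - y₁ * hsy + h₁ - hre + hp)

lemma det_ne_zero_of_affineIndependent {P₁ P₂ P₃ : Pt}
    (h : AffineIndependent ℝ ![P₁, P₂, P₃]) :
    P₁ 0 * P₂ 1 - P₂ 0 * P₁ 1 + (P₂ 0 * P₃ 1 - P₃ 0 * P₂ 1)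
      + (P₃ 0 * P₁ 1 - P₁ 0 * P₃ 1) ≠ 0 := by
  intro hD
  have hdet : (!![1, P₁ 0, P₁ 1; 1, P₂ 0, P₂ 1; 1, P₃ 0, P₃ 1] : Matrix _ _ ℝ).det = 0 := by
    rw [Matrix.det_fin_three]
    simp
    linear_combination hD
  obtain ⟨w, hw, hwM⟩ := Matrix.exists_vecMul_eq_zero_iff.2 hdet
  have e0 := congrFun hwM 0
  have e1 := congrFun hwM 1
  have e2 := congrFun hwM 2
  simp [Matrix.vecMul, dotProduct, Fin.sum_univ_three] at e0 e1 e2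
  rw [affineIndependent_iff] at h
  apply hw
  ext i
  refine h Finset.univ w (by simpa [Fin.sum_univ_three] using e0) ?_ i (Finset.mem_univ i)
  ext j
  fin_cases j
  · simpa [Fin.sum_univ_three] using e1
  · simpa [Fin.sum_univ_three] using e2

/-- The constant term of the circle through three points of an ellipse `(a * x, b * y)` on
which `x ^ 2 - u` is a homogeneous linear form. -/
lemma circle_constant_term_eq {a b u α β k p q x₁ y₁ x₂ y₂ x₃ y₃ : ℝ}
    (hD : x₁ * y₂ - x₂ * y₁ + (x₂ * y₃ - x₃ * y₂) + (x₃ * y₁ - x₁ * y₃) ≠ 0)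
    (h₁ : x₁ ^ 2 + y₁ ^ 2 = 1) (h₂ : x₂ ^ 2 + y₂ ^ 2 = 1) (h₃ : x₃ ^ 2 + y₃ ^ 2 = 1)
    (l₁ : x₁ ^ 2 - u = α * x₁ + β * y₁) (l₂ : x₂ ^ 2 - u = α * x₂ + β * y₂)
    (l₃ : x₃ ^ 2 - u = α * x₃ + β * y₃)
    (k₁ : k + (a * x₁) ^ 2 + (b * y₁) ^ 2 = p * x₁ + q * y₁)
    (k₂ : k + (a * x₂) ^ 2 + (b * y₂) ^ 2 = p * x₂ + q * y₂)
    (k₃ : k + (a * x₃) ^ 2 + (b * y₃) ^ 2 = p * x₃ + q * y₃) :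
    k = -u * (a ^ 2 - b ^ 2) - b ^ 2 := by
  have key {x y : ℝ} (h : x ^ 2 + y ^ 2 = 1) (l : x ^ 2 - u = α * x + β * y)
      (hk : k + (a * x) ^ 2 + (b * y) ^ 2 = p * x + q * y) :
      k + b ^ 2 + u * (a ^ 2 - b ^ 2)
        = (p - (a ^ 2 - b ^ 2) * α) * x + (q - (a ^ 2 - b ^ 2) * β) * y := by
    linear_combination hk - b ^ 2 * h - (a ^ 2 - b ^ 2) * l
  have : (k + b ^ 2 + u * (a ^ 2 - b ^ 2)) *
      (x₁ * y₂ - x₂ * y₁ + (x₂ * y₃ - x₃ * y₂) + (x₃ * y₁ - x₁ * y₃)) = 0 := by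
    linear_combination (x₁ * y₂ - x₂ * y₁) * key h₃ l₃ k₃
      + (x₂ * y₃ - x₃ * y₂) * key h₁ l₁ k₁ + (x₃ * y₁ - x₁ * y₃) * key h₂ l₂ k₂
  have := (mul_eq_zero.1 this).resolve_right hD
  linarith

/-- The orthocenter in terms of the circumcenter: `H = P₁ + P₂ + P₃ - 2 O`, in coordinates. -/
lemma orthocenter_coord_eq {P₁ P₂ P₃ O H : Pt} {R : ℝ}
    (hD : P₁ 0 * P₂ 1 - P₂ 0 * P₁ 1 + (P₂ 0 * P₃ 1 - P₃ 0 * P₂ 1)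
      + (P₃ 0 * P₁ 1 - P₁ 0 * P₃ 1) ≠ 0)
    (k₁ : (O 0 - P₁ 0) ^ 2 + (O 1 - P₁ 1) ^ 2 = R ^ 2)
    (k₂ : (O 0 - P₂ 0) ^ 2 + (O 1 - P₂ 1) ^ 2 = R ^ 2)
    (k₃ : (O 0 - P₃ 0) ^ 2 + (O 1 - P₃ 1) ^ 2 = R ^ 2)
    (hH₁ : ⟪H - P₁, P₂ - P₃⟫ = 0) (hH₂ : ⟪H - P₂, P₃ - P₁⟫ = 0) :
    H 0 = P₁ 0 + P₂ 0 + P₃ 0 - 2 * O 0 ∧ H 1 = P₁ 1 + P₂ 1 + P₃ 1 - 2 * O 1 := by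
  simp only [PiLp.inner_apply, Fin.sum_univ_two, PiLp.sub_apply, RCLike.inner_apply,
    conj_trivial] at hH₁ hH₂
  have f₁ : (H 0 - (P₁ 0 + P₂ 0 + P₃ 0 - 2 * O 0)) * (P₂ 0 - P₃ 0)
      + (H 1 - (P₁ 1 + P₂ 1 + P₃ 1 - 2 * O 1)) * (P₂ 1 - P₃ 1) = 0 := by
    linear_combination hH₁ + k₃ - k₂
  have f₂ : (H 0 - (P₁ 0 + P₂ 0 + P₃ 0 - 2 * O 0)) * (P₃ 0 - P₁ 0)
      + (H 1 - (P₁ 1 + P₂ 1 + P₃ 1 - 2 * O 1)) * (P₃ 1 - P₁ 1) = 0 := by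
    linear_combination hH₂ + k₁ - k₃
  constructor
  · refine mul_right_cancel₀ hD ?_
    linear_combination (P₃ 1 - P₁ 1) * f₁ - (P₂ 1 - P₃ 1) * f₂
  · refine mul_right_cancel₀ hD ?_
    linear_combination (P₂ 0 - P₃ 0) * f₂ - (P₃ 0 - P₁ 0) * f₁

/-- invariant power of the center, concentric axis-aligned pair.
For the concentric axis-aligned pair with `a_c/a + b_c/b = 1`, every Poncelet
3-periodic has power of the origin wrt the circumcircle equal to `−(a_c/a)·c² − b²`
and wrt the nine-point circle equal to `−a_c·(a − a_c)·(a² + b²)/(2a²)`. -/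
theorem power_center_concentric_aligned
    (a b c a_c b_c : ℝ)
    (hab : a > b) (hb : b > 0)
    (hc : c ^ 2 = a ^ 2 - b ^ 2)
    (hac : 0 < a_c) (hbc : 0 < b_c) (haca : a_c < a) (hbcb : b_c < b)
    (hcayley : a_c / a + b_c / b = 1)
    (E E_c : Set Pt)
    (hE : E = {P : Pt | (P 0) ^ 2 / a ^ 2 + (P 1) ^ 2 / b ^ 2 = 1})
    (hEc : E_c = {P : Pt | (P 0) ^ 2 / a_c ^ 2 + (P 1) ^ 2 / b_c ^ 2 = 1})
    (P₁ P₂ P₃ : Pt)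
    (hP₁ : P₁ ∈ E) (hP₂ : P₂ ∈ E) (hP₃ : P₃ ∈ E)
    (hnd : AffineIndependent ℝ ![P₁, P₂, P₃])
    (hcirc : Circumscribes P₁ P₂ P₃ E_c)
    (O : Pt) (R : ℝ)
    (hO₁ : dist O P₁ = R) (hO₂ : dist O P₂ = R) (hO₃ : dist O P₃ = R)
    (H : Pt)
    (hH₁ : ⟪H - P₁, P₂ - P₃⟫ = 0)
    (hH₂ : ⟪H - P₂, P₃ - P₁⟫ = 0)
    (hH₃ : ⟪H - P₃, P₁ - P₂⟫ = 0) :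
    circlePower 0 O R = -(a_c / a) * c ^ 2 - b ^ 2 ∧
    circlePower 0 (midpoint ℝ O H) (R / 2) =
      -a_c * (a - a_c) * (a ^ 2 + b ^ 2) / (2 * a ^ 2) := by
  have ha : 0 < a := by linarith
  have hx (P : Pt) : P ∈ E → (P 0 / a) ^ 2 + (P 1 / b) ^ 2 = 1 := by
    rw [hE]
    intro h
    simpa [div_pow] using h
  have hu : 0 < a_c / a := by positivity
  have hv : 0 < b_c / b := by positivity
  have hD := det_ne_zero_of_affineIndependent hnd
  have h₁₂ : P₁ ≠ P₂ := fun h => by simpa using hnd.injective.ne (show (0 : Fin 3) ≠ 1 by decide) h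
  have h₂₃ : P₂ ≠ P₃ := fun h => by simpa using hnd.injective.ne (show (1 : Fin 3) ≠ 2 by decide) h
  have h₃₁ : P₃ ≠ P₁ := fun h => by simpa using hnd.injective.ne (show (2 : Fin 3) ≠ 0 by decide) h
  obtain ⟨t₁₂, t₂₃, t₃₁, -⟩ := hcirc
  rw [hEc] at t₁₂ t₂₃ t₃₁
  have hne {A B : Pt} (h : A ≠ B) : A 0 / a ≠ B 0 / a ∨ A 1 / b ≠ B 1 / b := by
    by_contra! hcon
    rw [div_left_inj' ha.ne', div_left_inj' hb.ne'] at hcon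
    exact h (by ext i; fin_cases i <;> simp [hcon.1, hcon.2])
  have hchord {A B : Pt} (hA : A ∈ E) (hB : B ∈ E) (hAB : A ≠ B)
      (ht : IsTangentLine (sideline A B)
        {P : Pt | (P 0) ^ 2 / a_c ^ 2 + (P 1) ^ 2 / b_c ^ 2 = 1}) :
      b_c / b * (A 0 / a * (B 0 / a)) + a_c / a * (A 1 / b * (B 1 / b))
        = -(a_c / a * (b_c / b)) := by
    refine chord_relation_of_discriminant_eq_zero hcayley (hx A hA) (hx B hB) (hne hAB) ?_
    have := ht.discriminant_eq_zero hac.ne' hbc.ne' hAB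
    field_simp
    linear_combination this
  have c₁₂ := hchord hP₁ hP₂ h₁₂ t₁₂
  have c₂₃ := hchord hP₂ hP₃ h₂₃ t₂₃
  have c₃₁ := hchord hP₃ hP₁ h₃₁ t₃₁
  have e₁ := hx P₁ hP₁
  have e₂ := hx P₂ hP₂
  have e₃ := hx P₃ hP₃
  obtain ⟨hre, him⟩ := esymm_two_of_chord_relations hu hv hcayley e₁ e₂ e₃ (hne h₂₃) c₁₂
    (by linarith)
  have l₁ := sq_sub_eq_linear_of_esymm_two hcayley e₁ e₂ e₃ hre him
  have l₂ := sq_sub_eq_linear_of_esymm_two hcayley e₂ e₃ e₁ (by linarith) (by linarith)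
  have l₃ := sq_sub_eq_linear_of_esymm_two hcayley e₃ e₁ e₂ (by linarith) (by linarith)
  have hcircle {P : Pt} (h : dist O P = R) : (O 0 - P 0) ^ 2 + (O 1 - P 1) ^ 2 = R ^ 2 := by
    rw [← h, EuclideanSpace.dist_sq_eq, Fin.sum_univ_two, Real.dist_eq, Real.dist_eq, sq_abs,
      sq_abs]
  have k₁ := hcircle hO₁
  have k₂ := hcircle hO₂
  have k₃ := hcircle hO₃
  obtain ⟨hH0, hH1⟩ := orthocenter_coord_eq hD k₁ k₂ k₃ hH₁ hH₂
  have hpow (X : Pt) (ρ : ℝ) : circlePower 0 X ρ = X 0 ^ 2 + X 1 ^ 2 - ρ ^ 2 := by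
    simp [circlePower, EuclideanSpace.norm_sq_eq, Fin.sum_univ_two]
  have hN (i : Fin 2) : (midpoint ℝ O H) i = (O i + H i) / 2 := by
    simp [midpoint_eq_smul_add]
    ring
  rw [hpow, hpow, hN, hN, hH0, hH1, hc]
  have cx (P : Pt) : P 0 = a * (P 0 / a) := by field_simp
  have cy (P : Pt) : P 1 = b * (P 1 / b) := by field_simp
  rw [cx P₁, cy P₁, cx P₂, cy P₂, cx P₃, cy P₃] at hD
  rw [cx P₁, cy P₁] at k₁ ⊢
  rw [cx P₂, cy P₂] at k₂ ⊢
  rw [cx P₃, cy P₃] at k₃ ⊢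
  generalize P₁ 0 / a = x₁ at *
  generalize P₂ 0 / a = x₂ at *
  generalize P₃ 0 / a = x₃ at *
  generalize P₁ 1 / b = y₁ at *
  generalize P₂ 1 / b = y₂ at *
  generalize P₃ 1 / b = y₃ at *
  have hrhs : -a_c * (a - a_c) * (a ^ 2 + b ^ 2) / (2 * a ^ 2)
      = -(a_c / a) * (1 - a_c / a) * (a ^ 2 + b ^ 2) / 2 := by
    field_simp
  rw [hrhs]
  generalize a_c / a = u at *
  generalize b_c / b = v at *
  obtain rfl : v = 1 - u := by linarith
  have hD' : x₁ * y₂ - x₂ * y₁ + (x₂ * y₃ - x₃ * y₂) + (x₃ * y₁ - x₁ * y₃) ≠ 0 := by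
    intro h
    exact hD (by linear_combination a * b * h)
  have hK : O 0 ^ 2 + O 1 ^ 2 - R ^ 2 = -u * (a ^ 2 - b ^ 2) - b ^ 2 := by
    refine circle_constant_term_eq (p := 2 * a * O 0) (q := 2 * b * O 1) hD' e₁ e₂ e₃ l₁
      (l₂.trans (by ring)) (l₃.trans (by ring)) ?_ ?_ ?_
    · linear_combination k₁
    · linear_combination k₂
    · linear_combination k₃
  have hxx : x₁ * x₂ + x₁ * x₃ + x₂ * x₃ = -u * (2 - u) := by
    linear_combination u * hre + c₁₂ + c₂₃ + c₃₁
  have hyy : y₁ * y₂ + y₁ * y₃ + y₂ * y₃ = -(1 - u) * (1 + u) := by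
    linear_combination hxx - hre
  refine ⟨hK, ?_⟩
  linear_combination (1 / 4) * (k₁ + k₂ + k₃) - (1 / 2) * hK + (a ^ 2 / 2) * hxx
    + (b ^ 2 / 2) * hyy
end
end

section
/- Let R > 0 and a_c ≥ b_c > 0 with a_c + b_c = R. Let T_R be the circle of radius R centered at the origin and E_c = {(x,y) ∈ ℝ² : x²/a_c² + y²/b_c² = 1}. Then for every triangle with vertices on T_R that circumscribes E_c, the distance from the origin to the center N of the nine-point circle equals (a_c − b_c)/2; that is, the locus of the nine-point center over this Poncelet family lies on the circle of radius (a_c − b_c)/2 centered at the common center. -/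
open scoped RealInnerProductSpace

noncomputable section

/-- A nonzero vector cannot be orthogonal to two linearly independent plane vectors. -/
theorem eq_zero_of_dot_eq_zero {u v x y k l : ℝ} (hd : u * y - v * x ≠ 0)
    (h₁ : k * u + l * v = 0) (h₂ : k * x + l * y = 0) : k = 0 ∧ l = 0 := by
  constructor
  · refine (mul_eq_zero.mp ?_).resolve_right hd
    linear_combination y * h₁ - v * h₂
  · refine (mul_eq_zero.mp ?_).resolve_right hd
    linear_combination u * h₂ - x * h₁

theorem AffineIndependent.det_ne_zero {A B C : Pt} (h : AffineIndependent ℝ ![A, B, C]) :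
    (B 0 - A 0) * (C 1 - A 1) - (B 1 - A 1) * (C 0 - A 0) ≠ 0 := by
  intro hd
  have key : ∀ s t : ℝ, s * (B 0 - A 0) + t * (C 0 - A 0) = 0 →
      s * (B 1 - A 1) + t * (C 1 - A 1) = 0 → s = 0 ∧ t = 0 := by
    intro s t h0 h1
    have hs := affineIndependent_iff.mp h Finset.univ ![-s - t, s, t]
      (by simp [Fin.sum_univ_three]; ring)
      (by
        ext i
        fin_cases i
        · simp [Fin.sum_univ_three]; linear_combination h0
        · simp [Fin.sum_univ_three]; linear_combination h1)
    exact ⟨by simpa using hs 1 (Finset.mem_univ _), by simpa using hs 2 (Finset.mem_univ _)⟩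
  obtain ⟨h1, h2⟩ := key (C 0 - A 0) (-(B 0 - A 0)) (by ring) (by linear_combination -hd)
  obtain ⟨h3, h4⟩ := key (C 1 - A 1) (-(B 1 - A 1)) (by linear_combination hd) (by ring)
  have := (key 1 0 (by linarith) (by linarith)).1
  exact one_ne_zero this

/-- The discriminant condition for tangency of a sideline to an axis-parallel ellipse. -/
theorem IsTangentLine.ellipse_discrim {a b : ℝ} (ha : 0 < a) (hb : 0 < b) {A B : Pt}
    (h : IsTangentLine (sideline A B) {P : Pt | P 0 ^ 2 / a ^ 2 + P 1 ^ 2 / b ^ 2 = 1})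
    (hAB : (B 0 - A 0) ^ 2 + (B 1 - A 1) ^ 2 ≠ 0) :
    a ^ 2 * (B 1 - A 1) ^ 2 + b ^ 2 * (B 0 - A 0) ^ 2 =
      (A 0 * (B 1 - A 1) - A 1 * (B 0 - A 0)) ^ 2 := by
  obtain ⟨Q, ⟨⟨t, rfl⟩, hQ⟩, huniq⟩ := h
  set p := A 0
  set q := A 1
  set u := B 0 - A 0
  set v := B 1 - A 1
  have hE : ∀ s : ℝ, A + s • (B - A) ∈ {P : Pt | P 0 ^ 2 / a ^ 2 + P 1 ^ 2 / b ^ 2 = 1} ↔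
      b ^ 2 * (p + s * u) ^ 2 + a ^ 2 * (q + s * v) ^ 2 = a ^ 2 * b ^ 2 := by
    intro s
    simp only [Set.mem_ofPred_eq, PiLp.add_apply, PiLp.smul_apply, PiLp.sub_apply, smul_eq_mul]
    field_simp
    constructor <;> intro h <;> linear_combination h
  have hpos : 0 < b ^ 2 * u ^ 2 + a ^ 2 * v ^ 2 := by
    by_cases hu0 : u = 0
    · have hv0 : v ≠ 0 := by
        rintro hv0
        exact hAB (by rw [hu0, hv0]; ring)
      positivity
    · positivity
  rw [hE] at hQ
  set D := b ^ 2 * u ^ 2 + a ^ 2 * v ^ 2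
  set M := b ^ 2 * p * u + a ^ 2 * q * v
  obtain ⟨t', ht'⟩ : ∃ t', D * t' = -2 * M - D * t := ⟨(-2 * M - D * t) / D, by field_simp⟩
  have hQ' : b ^ 2 * (p + t' * u) ^ 2 + a ^ 2 * (q + t' * v) ^ 2 = a ^ 2 * b ^ 2 := by
    linear_combination hQ + (t' - t) * ht'
  have heq := huniq _ ⟨⟨t', rfl⟩, (hE t').mpr hQ'⟩
  have e0 := congrArg (fun P : Pt => P 0) heq
  have e1 := congrArg (fun P : Pt => P 1) heq
  simp only [PiLp.add_apply, PiLp.smul_apply, PiLp.sub_apply, smul_eq_mul] at e0 e1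
  have htt : t' = t := by
    refine sub_eq_zero.mp ((mul_eq_zero.mp ?_).resolve_right hpos.ne')
    linear_combination b ^ 2 * u * e0 + a ^ 2 * v * e1
  rw [htt] at ht'
  have hM' : M = -(D * t) := by linarith
  have : a ^ 2 * b ^ 2 * (a ^ 2 * v ^ 2 + b ^ 2 * u ^ 2 - (p * v - q * u) ^ 2) = 0 := by
    linear_combination (-D) * hQ + (M + D * t) * hM'
  have hab : a ^ 2 * b ^ 2 ≠ 0 := by positivity
  linarith [(mul_eq_zero.mp this).resolve_left hab]

/-- A chord of the circle of radius `a + b` is tangent to the ellipse with semi-axes `a`, `b` only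
if its endpoints are conjugate for the diagonal form `x² / a + y² / b`, up to the constant. -/
theorem conj_of_discrim {a b x y z w : ℝ} (ha : 0 < a) (hb : 0 < b)
    (h₁ : x ^ 2 + y ^ 2 = (a + b) ^ 2) (h₂ : z ^ 2 + w ^ 2 = (a + b) ^ 2)
    (hne : (z - x) ^ 2 + (w - y) ^ 2 ≠ 0)
    (h : a ^ 2 * (w - y) ^ 2 + b ^ 2 * (z - x) ^ 2 = (x * (w - y) - y * (z - x)) ^ 2) :
    b * (x * z) + a * (y * w) = -(a * b * (a + b)) := by
  have hc : (a + b) ^ 2 - (x * z + y * w) ≠ 0 := by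
    intro h0
    exact hne (by linear_combination h₁ + h₂ + 2 * h0)
  have hcross : (x * (w - y) - y * (z - x)) ^ 2 =
      ((a + b) ^ 2 - (x * z + y * w)) * ((a + b) ^ 2 + (x * z + y * w)) := by
    linear_combination (z ^ 2 + w ^ 2) * h₁ + (a + b) ^ 2 * h₂
  have hdiff : (a + b) ^ 2 * ((z - x) ^ 2 - (w - y) ^ 2) =
      -2 * (x * z - y * w) * ((a + b) ^ 2 - (x * z + y * w)) := by
    linear_combination -(x ^ 2 - y ^ 2) * h₂ - (z ^ 2 - w ^ 2) * h₁
  have hsum : (z - x) ^ 2 + (w - y) ^ 2 = 2 * ((a + b) ^ 2 - (x * z + y * w)) := by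
    linear_combination h₁ + h₂
  have hmul : ((a + b) ^ 2 - (x * z + y * w)) *
      ((a + b) * (b * (x * z) + a * (y * w) + a * b * (a + b))) = 0 := by
    linear_combination (-(a + b) ^ 2 / 2) * h - (a + b) ^ 2 / 2 * hcross
      - (a ^ 2 - b ^ 2) / 4 * hdiff + (a + b) ^ 2 * (a ^ 2 + b ^ 2) / 4 * hsum
  have hab : a + b ≠ 0 := by positivity
  have := (mul_eq_zero.mp ((mul_eq_zero.mp hmul).resolve_left hc)).resolve_left hab
  linarith

/-- The sum of three points of the circle of radius `a + b`, the first of which is conjugate to the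
other two, has norm `|a - b|`. -/
theorem sq_add_sq_sum_of_conj {a b x₁ y₁ x₂ y₂ x₃ y₃ : ℝ} (ha : 0 < a) (hb : 0 < b)
    (h₁ : x₁ ^ 2 + y₁ ^ 2 = (a + b) ^ 2) (h₂ : x₂ ^ 2 + y₂ ^ 2 = (a + b) ^ 2)
    (h₃ : x₃ ^ 2 + y₃ ^ 2 = (a + b) ^ 2) (hne : (x₃ - x₂) ^ 2 + (y₃ - y₂) ^ 2 ≠ 0)
    (h₁₂ : b * (x₁ * x₂) + a * (y₁ * y₂) = -(a * b * (a + b)))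
    (h₁₃ : b * (x₁ * x₃) + a * (y₁ * y₃) = -(a * b * (a + b))) :
    (x₁ + x₂ + x₃) ^ 2 + (y₁ + y₂ + y₃) ^ 2 = (a - b) ^ 2 := by
  set S := x₂ + x₃
  set T := y₂ + y₃
  set N := b ^ 2 * x₁ ^ 2 + a ^ 2 * y₁ ^ 2
  have hdot : b * x₁ * S + a * y₁ * T = -2 * (a * b * (a + b)) := by
    linear_combination h₁₂ + h₁₃
  have hd₁ : (x₃ - x₂) * (b * x₁) + (y₃ - y₂) * (a * y₁) = 0 := by
    linear_combination h₁₃ - h₁₂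
  have hd₂ : (x₃ - x₂) * S + (y₃ - y₂) * T = 0 := by
    linear_combination h₃ - h₂
  have hpar : b * x₁ * T - a * y₁ * S = 0 := by
    by_contra hd
    obtain ⟨h0, h0'⟩ := eq_zero_of_dot_eq_zero hd hd₁ hd₂
    exact hne (by rw [h0, h0']; ring)
  have hNpos : N ≠ 0 := by
    intro h0
    have hx : (b * x₁) ^ 2 = 0 := by nlinarith [sq_nonneg (b * x₁), sq_nonneg (a * y₁)]
    have hy : (a * y₁) ^ 2 = 0 := by nlinarith [sq_nonneg (b * x₁), sq_nonneg (a * y₁)]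
    have hx' := pow_eq_zero_iff two_ne_zero |>.mp hx
    have hy' := pow_eq_zero_iff two_ne_zero |>.mp hy
    rw [hx', hy'] at hdot
    have : 0 < a * b * (a + b) := by positivity
    linarith
  have hST : N * (S ^ 2 + T ^ 2) = 4 * (a * b * (a + b)) ^ 2 := by
    linear_combination (b * x₁ * S + a * y₁ * T - 2 * (a * b * (a + b))) * hdot
      + (b * x₁ * T - a * y₁ * S) * hpar
  have hNS : N * S = -2 * (a * b * (a + b)) * (b * x₁) := by
    linear_combination b * x₁ * hdot - a * y₁ * hpar
  have hNT : N * T = -2 * (a * b * (a + b)) * (a * y₁) := by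
    linear_combination a * y₁ * hdot + b * x₁ * hpar
  refine sub_eq_zero.mp ((mul_eq_zero.mp ?_).resolve_left hNpos)
  linear_combination N * h₁ + hST + 2 * x₁ * hNS + 2 * y₁ * hNT
    - 4 * a ^ 2 * b ^ 2 * h₁

/-- pair with circumcircle: circular locus of the nine-point center.
For the pair consisting of the circle of radius `R` centered at the origin and the
concentric inellipse with semi-axes `a_c ≥ b_c > 0`, `a_c + b_c = R`, the nine-point
center `N` of every Poncelet 3-periodic lies at distance `(a_c − b_c)/2` from the
origin. -/
theorem ninepoint_locus_circumcircle_pair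
    (R a_c b_c : ℝ)
    (hR : 0 < R) (hcc : a_c ≥ b_c) (hbc : 0 < b_c)
    (hcayley : a_c + b_c = R)
    (T_R E_c : Set Pt)
    (hT : T_R = {P : Pt | (P 0) ^ 2 + (P 1) ^ 2 = R ^ 2})
    (hEc : E_c = {P : Pt | (P 0) ^ 2 / a_c ^ 2 + (P 1) ^ 2 / b_c ^ 2 = 1})
    (P₁ P₂ P₃ : Pt)
    (hP₁ : P₁ ∈ T_R) (hP₂ : P₂ ∈ T_R) (hP₃ : P₃ ∈ T_R)
    (hnd : AffineIndependent ℝ ![P₁, P₂, P₃])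
    (hcirc : Circumscribes P₁ P₂ P₃ E_c)
    -- circumcenter `O` and circumradius `ρ` of the triangle
    (O : Pt) (ρ : ℝ)
    (hO₁ : dist O P₁ = ρ) (hO₂ : dist O P₂ = ρ) (hO₃ : dist O P₃ = ρ)
    (H : Pt)
    (hH₁ : ⟪H - P₁, P₂ - P₃⟫ = 0)
    (hH₂ : ⟪H - P₂, P₃ - P₁⟫ = 0)
    (hH₃ : ⟪H - P₃, P₁ - P₂⟫ = 0) :
    dist (0 : Pt) (midpoint ℝ O H) = (a_c - b_c) / 2 := by
  subst hT hEc hcayley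
  have ha : 0 < a_c := hbc.trans_le hcc
  simp only [Set.mem_ofPred_eq] at hP₁ hP₂ hP₃
  have hd := hnd.det_ne_zero
  obtain ⟨ht₁₂, -, ht₃₁, -⟩ := hcirc
  have n₁₂ : (P₂ 0 - P₁ 0) ^ 2 + (P₂ 1 - P₁ 1) ^ 2 ≠ 0 := fun h => hd (by
    rw [show P₂ 0 - P₁ 0 = 0 by nlinarith, show P₂ 1 - P₁ 1 = 0 by nlinarith]; ring)
  have n₃₁ : (P₁ 0 - P₃ 0) ^ 2 + (P₁ 1 - P₃ 1) ^ 2 ≠ 0 := fun h => hd (by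
    rw [show P₃ 0 - P₁ 0 = 0 by nlinarith, show P₃ 1 - P₁ 1 = 0 by nlinarith]; ring)
  have n₂₃ : (P₃ 0 - P₂ 0) ^ 2 + (P₃ 1 - P₂ 1) ^ 2 ≠ 0 := fun h => hd (by
    rw [show P₃ 0 = P₂ 0 by nlinarith, show P₃ 1 = P₂ 1 by nlinarith]; ring)
  have c₁₂ := conj_of_discrim ha hbc hP₁ hP₂ n₁₂ (ht₁₂.ellipse_discrim ha hbc n₁₂)
  have c₃₁ := conj_of_discrim ha hbc hP₃ hP₁ n₃₁ (ht₃₁.ellipse_discrim ha hbc n₃₁)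
  have hsum := sq_add_sq_sum_of_conj ha hbc hP₁ hP₂ hP₃ n₂₃ c₁₂ (by linear_combination c₃₁)
  have sq_dist : ∀ P : Pt, dist O P = ρ → (O 0 - P 0) ^ 2 + (O 1 - P 1) ^ 2 = ρ ^ 2 := by
    rintro P rfl
    rw [EuclideanSpace.dist_sq_eq]
    simp [Real.dist_eq, Fin.sum_univ_two, sq_abs]
  have o₁ := sq_dist _ hO₁
  have o₂ := sq_dist _ hO₂
  have o₃ := sq_dist _ hO₃
  obtain ⟨hO0, hO1⟩ : O 0 = 0 ∧ O 1 = 0 := eq_zero_of_dot_eq_zero hd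
    (by linear_combination (o₁ - o₂ + hP₂ - hP₁) / 2)
    (by linear_combination (o₁ - o₃ + hP₃ - hP₁) / 2)
  simp only [PiLp.inner_apply, Fin.sum_univ_two, PiLp.sub_apply, RCLike.inner_apply, conj_trivial]
    at hH₂ hH₃
  obtain ⟨hH0, hH1⟩ : H 0 - (P₁ 0 + P₂ 0 + P₃ 0) = 0 ∧ H 1 - (P₁ 1 + P₂ 1 + P₃ 1) = 0 :=
    eq_zero_of_dot_eq_zero hd
      (by linear_combination -hH₃ + hP₁ - hP₂)
      (by linear_combination hH₂ - hP₃ + hP₁)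
  have hm : ∀ i, midpoint ℝ O H i = (O i + H i) / 2 := fun i => by
    simp [midpoint_eq_smul_add]
    ring
  rw [EuclideanSpace.dist_eq, Fin.sum_univ_two, Real.dist_eq, Real.dist_eq, sq_abs, sq_abs, hm, hm,
    Real.sqrt_eq_iff_mul_self_eq (by positivity) (by linarith), hO0, hO1, sub_eq_zero.mp hH0,
    sub_eq_zero.mp hH1]
  simp only [PiLp.zero_apply]
  linear_combination hsum / 4
end
end

section
/- Let R > 0 and a_c ≥ b_c > 0 with a_c + b_c = R. Let T_R be the circle of radius R centered at the origin and E_c = {(x,y) ∈ ℝ² : x²/a_c² + y²/b_c² = 1}. Then for every triangle with vertices on T_R that circumscribes E_c, the power of the origin with respect to the circumcircle equals −R², and the power of the origin with respect to the nine-point circle equals −a_c·b_c. -/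
open scoped RealInnerProductSpace

noncomputable section

/-- A vector orthogonal to two sides of a nondegenerate triangle vanishes. -/
lemma eq_zero_of_orthogonal_sides {A B C : Pt} (h : AffineIndependent ℝ ![A, B, C])
    {u v : ℝ} (hB : u * (B 0 - A 0) + v * (B 1 - A 1) = 0)
    (hC : u * (C 0 - A 0) + v * (C 1 - A 1) = 0) : u = 0 ∧ v = 0 := by
  by_contra hne
  have hpos : u ^ 2 + v ^ 2 ≠ 0 := by
    intro h0
    exact hne ⟨by nlinarith [sq_nonneg u, sq_nonneg v], by nlinarith [sq_nonneg u, sq_nonneg v]⟩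
  have key : ∀ X : Pt, u * (X 0 - A 0) + v * (X 1 - A 1) = 0 →
      ∃ r : ℝ, X = r • (!₂[-v, u] : Pt) +ᵥ A := by
    intro X hX
    refine ⟨(u * (X 1 - A 1) - v * (X 0 - A 0)) / (u ^ 2 + v ^ 2), ?_⟩
    ext i
    fin_cases i
    · simp
      field_simp
      linear_combination u * hX
    · simp
      field_simp
      linear_combination v * hX
  rw [affineIndependent_iff_not_collinear_set] at h
  refine h ((collinear_iff_of_mem (p₀ := A) (by simp)).2 ⟨!₂[-v, u], ?_⟩)
  rintro X (rfl | rfl | rfl)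
  · exact key _ (by ring)
  · exact key _ hB
  · exact key _ hC

/-- If a quadratic with nonzero leading coefficient has exactly one root, its discriminant
vanishes. -/
lemma discrim_eq_zero_of_unique_root {p q r t : ℝ} (hp : p ≠ 0)
    (ht : p * t ^ 2 + q * t + r = 0)
    (huniq : ∀ s : ℝ, p * s ^ 2 + q * s + r = 0 → s = t) : q ^ 2 = 4 * p * r := by
  have h := huniq (-q / p - t) (by field_simp; linear_combination p * ht)
  have h2 : q = -2 * p * t := by
    field_simp at h
    linear_combination -h
  rw [h2] at ht ⊢
  linear_combination -4 * p * ht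

/-- A chord `AB` of the circle of radius `a + b` centered at the origin that is tangent to the
ellipse with semi-axes `a`, `b` has endpoints conjugate with respect to
`x² / a + y² / b = -(a + b)`. -/
lemma conjugate_of_tangent_chord {a b : ℝ} (ha : 0 < a) (hb : 0 < b) {A B : Pt} (hne : A ≠ B)
    (hA : A 0 ^ 2 + A 1 ^ 2 = (a + b) ^ 2) (hB : B 0 ^ 2 + B 1 ^ 2 = (a + b) ^ 2)
    (ht : IsTangentLine (sideline A B) {P : Pt | (P 0) ^ 2 / a ^ 2 + (P 1) ^ 2 / b ^ 2 = 1}) :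
    b * (A 0 * B 0) + a * (A 1 * B 1) = -(a * b * (a + b)) := by
  obtain ⟨Q, ⟨⟨t, rfl⟩, hQ⟩, huniq⟩ := ht
  have hd : 0 < (B 0 - A 0) ^ 2 + (B 1 - A 1) ^ 2 := by
    by_contra hle
    apply hne
    ext i
    fin_cases i
    · simp only [Fin.zero_eta]
      nlinarith [sq_nonneg (B 0 - A 0), sq_nonneg (B 1 - A 1)]
    · simp only [Fin.mk_one]
      nlinarith [sq_nonneg (B 0 - A 0), sq_nonneg (B 1 - A 1)]
  have hmem : ∀ s : ℝ, A + s • (B - A) ∈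
      {P : Pt | (P 0) ^ 2 / a ^ 2 + (P 1) ^ 2 / b ^ 2 = 1} ↔
      (b ^ 2 * (B 0 - A 0) ^ 2 + a ^ 2 * (B 1 - A 1) ^ 2) * s ^ 2
        + 2 * (b ^ 2 * (A 0 * (B 0 - A 0)) + a ^ 2 * (A 1 * (B 1 - A 1))) * s
        + (b ^ 2 * A 0 ^ 2 + a ^ 2 * A 1 ^ 2 - a ^ 2 * b ^ 2) = 0 := by
    intro s
    simp only [Set.mem_ofPred_eq, PiLp.add_apply, PiLp.smul_apply, PiLp.sub_apply, smul_eq_mul]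
    rw [div_add_div _ _ (by positivity) (by positivity), div_eq_one_iff_eq (by positivity)]
    constructor <;> intro h <;> linear_combination h
  have hlead : b ^ 2 * (B 0 - A 0) ^ 2 + a ^ 2 * (B 1 - A 1) ^ 2 ≠ 0 := by
    intro h0
    have h1 : 0 ≤ b ^ 2 * (B 0 - A 0) ^ 2 := by positivity
    have h2 : 0 ≤ a ^ 2 * (B 1 - A 1) ^ 2 := by positivity
    have h3 : (B 0 - A 0) ^ 2 = 0 :=
      (mul_eq_zero.1 (by linarith : b ^ 2 * (B 0 - A 0) ^ 2 = 0)).resolve_left (by positivity)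
    have h4 : (B 1 - A 1) ^ 2 = 0 :=
      (mul_eq_zero.1 (by linarith : a ^ 2 * (B 1 - A 1) ^ 2 = 0)).resolve_left (by positivity)
    linarith
  have hdisc := discrim_eq_zero_of_unique_root hlead ((hmem t).1 hQ) fun s hs => by
    have h := huniq (A + s • (B - A)) ⟨⟨s, rfl⟩, (hmem s).2 hs⟩
    exact smul_left_injective ℝ (sub_ne_zero.2 hne.symm) (add_left_cancel h)
  generalize A 0 = x at *
  generalize A 1 = y at *
  generalize B 0 = z at *
  generalize B 1 = w at *
  have hcross : (x * w - z * y) ^ 2 = a ^ 2 * (w - y) ^ 2 + b ^ 2 * (z - x) ^ 2 := by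
    have hab : 4 * a ^ 2 * b ^ 2 ≠ 0 := by positivity
    apply mul_left_cancel₀ hab
    linear_combination -hdisc
  have hR : (a + b) ^ 2 ≠ 0 := by positivity
  have hc : (a + b) ^ 2 - (x * z + y * w) ≠ 0 := by
    intro h0
    linarith [sq_nonneg (z - x)]
  have hx : ((a + b) ^ 2 - (x * z + y * w)) * ((a + b) ^ 2 - (x * z - y * w))
      = (a + b) ^ 2 * (z - x) ^ 2 := by
    linear_combination (z ^ 2 - (a + b) ^ 2) * hA - y ^ 2 * hB
  have hy : ((a + b) ^ 2 - (x * z + y * w)) * ((a + b) ^ 2 + (x * z - y * w))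
      = (a + b) ^ 2 * (w - y) ^ 2 := by
    linear_combination (w ^ 2 - (a + b) ^ 2) * hA - x ^ 2 * hB
  have hfin : (a + b) ^ 2 * ((a + b) ^ 2 + (x * z + y * w))
      = a ^ 2 * ((a + b) ^ 2 + (x * z - y * w)) + b ^ 2 * ((a + b) ^ 2 - (x * z - y * w)) := by
    apply mul_left_cancel₀ hc
    have hl : (x * w - z * y) ^ 2 = (a + b) ^ 4 - (x * z + y * w) ^ 2 := by
      linear_combination (z ^ 2 + w ^ 2) * hA + (a + b) ^ 2 * hB
    linear_combination (a + b) ^ 2 * (hcross - hl) - a ^ 2 * hy - b ^ 2 * hx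
  apply mul_left_cancel₀ (by positivity : 2 * (a + b) ≠ 0)
  linear_combination hfin

/-- If `(x₁, y₁)` is conjugate to two distinct points of the circle of radius `a + b` with respect
to `x² / a + y² / b = -(a + b)`, the sum of the three points has norm `|a - b|`. -/
lemma sq_sum_of_conjugate {a b x₁ y₁ x₂ y₂ x₃ y₃ : ℝ} (ha : 0 < a) (hb : 0 < b)
    (h₁ : x₁ ^ 2 + y₁ ^ 2 = (a + b) ^ 2) (h₂ : x₂ ^ 2 + y₂ ^ 2 = (a + b) ^ 2)
    (h₃ : x₃ ^ 2 + y₃ ^ 2 = (a + b) ^ 2) (hne : x₂ ≠ x₃ ∨ y₂ ≠ y₃)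
    (h₁₂ : b * (x₁ * x₂) + a * (y₁ * y₂) = -(a * b * (a + b)))
    (h₁₃ : b * (x₁ * x₃) + a * (y₁ * y₃) = -(a * b * (a + b))) :
    (x₁ + x₂ + x₃) ^ 2 + (y₁ + y₂ + y₃) ^ 2 = (a - b) ^ 2 := by
  have hpar : b * x₁ * (y₂ + y₃) = a * y₁ * (x₂ + x₃) := by
    have hx : (x₂ - x₃) * (b * x₁ * (y₂ + y₃) - a * y₁ * (x₂ + x₃)) = 0 := by
      linear_combination (y₂ + y₃) * (h₁₂ - h₁₃) - a * y₁ * (h₂ - h₃)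
    have hy : (y₂ - y₃) * (b * x₁ * (y₂ + y₃) - a * y₁ * (x₂ + x₃)) = 0 := by
      linear_combination b * x₁ * (h₂ - h₃) - (x₂ + x₃) * (h₁₂ - h₁₃)
    rcases hne with h | h
    · linarith [(mul_eq_zero.1 hx).resolve_left (sub_ne_zero.2 h)]
    · linarith [(mul_eq_zero.1 hy).resolve_left (sub_ne_zero.2 h)]
  have hsum : b * x₁ * (x₂ + x₃) + a * y₁ * (y₂ + y₃) = -2 * (a * b * (a + b)) := by
    linear_combination h₁₂ + h₁₃
  have hE : (b * x₁) ^ 2 + (a * y₁) ^ 2 ≠ 0 := by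
    intro h0
    have hx : x₁ ^ 2 = 0 := by
      refine (mul_eq_zero.1 (?_ : b ^ 2 * x₁ ^ 2 = 0)).resolve_left (by positivity)
      linarith [sq_nonneg (b * x₁), sq_nonneg (a * y₁), mul_pow b x₁ 2]
    have hy : y₁ ^ 2 = 0 := by
      refine (mul_eq_zero.1 (?_ : a ^ 2 * y₁ ^ 2 = 0)).resolve_left (by positivity)
      linarith [sq_nonneg (b * x₁), sq_nonneg (a * y₁), mul_pow a y₁ 2]
    have : 0 < (a + b) ^ 2 := by positivity
    linarith
  rw [add_assoc x₁, add_assoc y₁]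
  generalize x₂ + x₃ = s at *
  generalize y₂ + y₃ = t at *
  have hs : ((b * x₁) ^ 2 + (a * y₁) ^ 2) * s = -2 * (a * b * (a + b)) * (b * x₁) := by
    linear_combination b * x₁ * hsum - a * y₁ * hpar
  have ht : ((b * x₁) ^ 2 + (a * y₁) ^ 2) * t = -2 * (a * b * (a + b)) * (a * y₁) := by
    linear_combination a * y₁ * hsum + b * x₁ * hpar
  have hst : ((b * x₁) ^ 2 + (a * y₁) ^ 2) * (s ^ 2 + t ^ 2) = 4 * (a * b * (a + b)) ^ 2 := by
    linear_combination s * hs + t * ht - 2 * (a * b * (a + b)) * hsum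
  apply mul_left_cancel₀ hE
  linear_combination ((b * x₁) ^ 2 + (a * y₁) ^ 2 - 4 * a ^ 2 * b ^ 2) * h₁
    + 2 * x₁ * hs + 2 * y₁ * ht + hst

/-- invariant power of the center, pair with circumcircle.
For the pair consisting of the circle of radius `R` centered at the origin and the
concentric inellipse with semi-axes `a_c ≥ b_c > 0`, `a_c + b_c = R`, every Poncelet
3-periodic has power of the origin wrt the circumcircle equal to `−R²` and wrt the
nine-point circle equal to `−a_c·b_c`. -/
theorem power_center_circumcircle_pair
    (R a_c b_c : ℝ)
    (hR : 0 < R) (hcc : a_c ≥ b_c) (hbc : 0 < b_c)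
    (hcayley : a_c + b_c = R)
    (T_R E_c : Set Pt)
    (hT : T_R = {P : Pt | (P 0) ^ 2 + (P 1) ^ 2 = R ^ 2})
    (hEc : E_c = {P : Pt | (P 0) ^ 2 / a_c ^ 2 + (P 1) ^ 2 / b_c ^ 2 = 1})
    (P₁ P₂ P₃ : Pt)
    (hP₁ : P₁ ∈ T_R) (hP₂ : P₂ ∈ T_R) (hP₃ : P₃ ∈ T_R)
    (hnd : AffineIndependent ℝ ![P₁, P₂, P₃])
    (hcirc : Circumscribes P₁ P₂ P₃ E_c)
    -- circumcenter `O` and circumradius `ρ` of the triangle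
    (O : Pt) (ρ : ℝ)
    (hO₁ : dist O P₁ = ρ) (hO₂ : dist O P₂ = ρ) (hO₃ : dist O P₃ = ρ)
    (H : Pt)
    (hH₁ : ⟪H - P₁, P₂ - P₃⟫ = 0)
    (hH₂ : ⟪H - P₂, P₃ - P₁⟫ = 0)
    (hH₃ : ⟪H - P₃, P₁ - P₂⟫ = 0) :
    circlePower 0 O ρ = -R ^ 2 ∧
    circlePower 0 (midpoint ℝ O H) (ρ / 2) = -(a_c * b_c) := by
  subst hT hEc hcayley
  simp only [Set.mem_ofPred_eq] at hP₁ hP₂ hP₃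
  have ha : 0 < a_c := lt_of_lt_of_le hbc hcc
  have hinj := hnd.injective
  have h12 : P₁ ≠ P₂ := hinj.ne (by decide : (0 : Fin 3) ≠ 1)
  have h23 : P₂ ≠ P₃ := hinj.ne (by decide : (1 : Fin 3) ≠ 2)
  have h31 : P₃ ≠ P₁ := hinj.ne (by decide : (2 : Fin 3) ≠ 0)
  obtain ⟨ht12, -, ht31, -⟩ := hcirc
  have hc12 := conjugate_of_tangent_chord ha hbc h12 hP₁ hP₂ ht12
  have hc31 := conjugate_of_tangent_chord ha hbc h31 hP₃ hP₁ ht31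
  have hne : P₂ 0 ≠ P₃ 0 ∨ P₂ 1 ≠ P₃ 1 := by
    by_contra! h
    exact h23 (by ext i; fin_cases i; exacts [h.1, h.2])
  have hsum := sq_sum_of_conjugate ha hbc hP₁ hP₂ hP₃ hne hc12 (by linear_combination hc31)
  have hdist : ∀ X Y : Pt, dist X Y ^ 2 = (X 0 - Y 0) ^ 2 + (X 1 - Y 1) ^ 2 := by
    intro X Y
    rw [EuclideanSpace.dist_eq, Real.sq_sqrt (by positivity), Fin.sum_univ_two,
      Real.dist_eq, Real.dist_eq, sq_abs, sq_abs]
  have hO₁' : (O 0 - P₁ 0) ^ 2 + (O 1 - P₁ 1) ^ 2 = ρ ^ 2 := by rw [← hdist, hO₁]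
  have hO₂' : (O 0 - P₂ 0) ^ 2 + (O 1 - P₂ 1) ^ 2 = ρ ^ 2 := by rw [← hdist, hO₂]
  have hO₃' : (O 0 - P₃ 0) ^ 2 + (O 1 - P₃ 1) ^ 2 = ρ ^ 2 := by rw [← hdist, hO₃]
  obtain ⟨hO0, hO1⟩ := eq_zero_of_orthogonal_sides (u := O 0) (v := O 1) hnd
    (by linear_combination (hO₁' - hO₂' - hP₁ + hP₂) / 2)
    (by linear_combination (hO₁' - hO₃' - hP₁ + hP₃) / 2)
  simp only [PiLp.inner_apply, Fin.sum_univ_two, PiLp.sub_apply, RCLike.inner_apply,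
    conj_trivial] at hH₂ hH₃
  obtain ⟨hH0, hH1⟩ := eq_zero_of_orthogonal_sides
    (u := H 0 - (P₁ 0 + P₂ 0 + P₃ 0)) (v := H 1 - (P₁ 1 + P₂ 1 + P₃ 1)) hnd
    (by linear_combination -hH₃ + hP₁ - hP₂)
    (by linear_combination hH₂ + hP₁ - hP₃)
  rw [sub_eq_zero] at hH0 hH1
  rw [hO0, hO1] at hO₁'
  have hmid : ∀ i, midpoint ℝ O H i = (O i + H i) / 2 := by
    intro i
    simp [midpoint_eq_smul_add]
    ring
  unfold circlePower
  rw [hdist, hdist, hmid, hmid, hO0, hO1, hH0, hH1]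
  simp only [PiLp.zero_apply]
  constructor
  · linear_combination hO₁' - hP₁
  · linear_combination hsum / 4 + hO₁' / 4 - hP₁ / 4
end
end

section
/- Let a > b > 0. Let E = {(x,y) ∈ ℝ² : x²/a² + y²/b² = 1} and E_c = {(x,y) ∈ ℝ² : x²/(a/2)² + y²/(b/2)² = 1} (the homothetic pair). Then for every triangle with vertices on E that circumscribes E_c, the power of the origin with respect to the circumcircle equals −(a² + b²)/2, and the power of the origin with respect to the nine-point circle equals −(a² + b²)/8. -/
open scoped RealInnerProductSpace

noncomputable section

/-- If both endpoints of a chord lie on an ellipse and the chord's line is tangent to the ellipse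
scaled by one half, then the midpoint of the chord lies on the smaller ellipse. -/
theorem midpoint_mem_of_isTangentLine {a b : ℝ} {P Q : Pt} (hPQ : P ≠ Q)
    (hP : P 0 ^ 2 / a ^ 2 + P 1 ^ 2 / b ^ 2 = 1) (hQ : Q 0 ^ 2 / a ^ 2 + Q 1 ^ 2 / b ^ 2 = 1)
    (h : IsTangentLine (sideline P Q)
      {X : Pt | X 0 ^ 2 / (a / 2) ^ 2 + X 1 ^ 2 / (b / 2) ^ 2 = 1}) :
    (P 0 / a + Q 0 / a) ^ 2 + (P 1 / b + Q 1 / b) ^ 2 = 1 := by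
  obtain ⟨X, ⟨⟨t, rfl⟩, hX⟩, huniq⟩ := h
  have hreflect := huniq (P + (1 - t) • (Q - P)) ⟨⟨1 - t, rfl⟩, by
    simp only [Set.mem_ofPred_eq, PiLp.add_apply, PiLp.smul_apply, PiLp.sub_apply,
      smul_eq_mul] at hX ⊢
    linear_combination hX - 4 * (2 * t - 1) * (hQ - hP)⟩
  have ht : t = 1 / 2 := by
    have := smul_left_injective ℝ (sub_ne_zero.2 hPQ.symm) (add_left_cancel hreflect)
    linarith
  subst ht
  simp only [Set.mem_ofPred_eq, PiLp.add_apply, PiLp.smul_apply, PiLp.sub_apply,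
    smul_eq_mul] at hX
  linear_combination hX

/-- Three unit vectors whose pairwise sums are unit vectors form an equilateral triangle: they
sum to zero, the squares of their coordinates sum to `3 / 2`, and the first two are linearly
independent. -/
theorem unit_vectors_of_unit_pairwise_sums {u₁ u₂ u₃ v₁ v₂ v₃ : ℝ}
    (h₁ : u₁ ^ 2 + v₁ ^ 2 = 1) (h₂ : u₂ ^ 2 + v₂ ^ 2 = 1) (h₃ : u₃ ^ 2 + v₃ ^ 2 = 1)
    (h₁₂ : (u₁ + u₂) ^ 2 + (v₁ + v₂) ^ 2 = 1) (h₂₃ : (u₂ + u₃) ^ 2 + (v₂ + v₃) ^ 2 = 1)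
    (h₃₁ : (u₃ + u₁) ^ 2 + (v₃ + v₁) ^ 2 = 1) :
    u₁ + u₂ + u₃ = 0 ∧ v₁ + v₂ + v₃ = 0 ∧ u₁ ^ 2 + u₂ ^ 2 + u₃ ^ 2 = 3 / 2 ∧
      v₁ ^ 2 + v₂ ^ 2 + v₃ ^ 2 = 3 / 2 ∧ u₁ * v₂ - u₂ * v₁ ≠ 0 := by
  have hsum : (u₁ + u₂ + u₃) ^ 2 + (v₁ + v₂ + v₃) ^ 2 = 0 := by
    linear_combination h₁₂ + h₂₃ + h₃₁ - h₁ - h₂ - h₃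
  obtain ⟨hu, hv⟩ := (add_eq_zero_iff_of_nonneg (sq_nonneg _) (sq_nonneg _)).1 hsum
  rw [sq_eq_zero_iff] at hu hv
  have hdot : v₁ * v₂ = -1 / 2 - u₁ * u₂ := by linear_combination (h₁₂ - h₁ - h₂) / 2
  have hv₁ : v₁ ^ 2 = 1 - u₁ ^ 2 := by linear_combination h₁
  have hv₂ : v₂ ^ 2 = 1 - u₂ ^ 2 := by linear_combination h₂
  have hprod : (-1 / 2 - u₁ * u₂) ^ 2 = (1 - u₁ ^ 2) * (1 - u₂ ^ 2) := by
    rw [← hdot, ← hv₁, ← hv₂]; ring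
  have hu₃ : u₃ = -u₁ - u₂ := by linear_combination hu
  have husq : u₁ ^ 2 + u₂ ^ 2 + u₃ ^ 2 = 3 / 2 := by
    rw [hu₃]; linear_combination 2 * hprod
  refine ⟨hu, hv, husq, by linear_combination h₁ + h₂ + h₃ - husq, fun hdet => ?_⟩
  have hlagrange : (u₁ * v₂ - u₂ * v₁) ^ 2 + (u₁ * u₂ + v₁ * v₂) ^ 2 =
      (u₁ ^ 2 + v₁ ^ 2) * (u₂ ^ 2 + v₂ ^ 2) := by ring
  rw [hdet, hdot, h₁, h₂] at hlagrange
  norm_num at hlagrange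

/-- invariant power of the center, homothetic pair.
For the homothetic pair of concentric ellipses with semi-axes `(a, b)` and `(a/2, b/2)`,
every Poncelet 3-periodic has power of the origin wrt the circumcircle equal to
`−(a² + b²)/2` and wrt the nine-point circle equal to `−(a² + b²)/8`. -/
theorem power_center_homothetic_pair
    (a b : ℝ)
    (hab : a > b) (hb : 0 < b)
    (E E_c : Set Pt)
    (hE : E = {P : Pt | (P 0) ^ 2 / a ^ 2 + (P 1) ^ 2 / b ^ 2 = 1})
    (hEc : E_c = {P : Pt | (P 0) ^ 2 / (a / 2) ^ 2 + (P 1) ^ 2 / (b / 2) ^ 2 = 1})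
    (P₁ P₂ P₃ : Pt)
    (hP₁ : P₁ ∈ E) (hP₂ : P₂ ∈ E) (hP₃ : P₃ ∈ E)
    (hnd : AffineIndependent ℝ ![P₁, P₂, P₃])
    (hcirc : Circumscribes P₁ P₂ P₃ E_c)
    (O : Pt) (R : ℝ)
    (hO₁ : dist O P₁ = R) (hO₂ : dist O P₂ = R) (hO₃ : dist O P₃ = R)
    (H : Pt)
    (hH₁ : ⟪H - P₁, P₂ - P₃⟫ = 0)
    (hH₂ : ⟪H - P₂, P₃ - P₁⟫ = 0)
    (hH₃ : ⟪H - P₃, P₁ - P₂⟫ = 0) :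
    circlePower 0 O R = -(a ^ 2 + b ^ 2) / 2 ∧
    circlePower 0 (midpoint ℝ O H) (R / 2) = -(a ^ 2 + b ^ 2) / 8 := by
  subst hE hEc
  simp only [Set.mem_ofPred_eq] at hP₁ hP₂ hP₃
  have ha : 0 < a := hb.trans hab
  obtain ⟨ht₁₂, ht₂₃, ht₃₁, -⟩ := hcirc
  have hne₁₂ : P₁ ≠ P₂ := hnd.injective.ne (show (0 : Fin 3) ≠ 1 by decide)
  have hne₂₃ : P₂ ≠ P₃ := hnd.injective.ne (show (1 : Fin 3) ≠ 2 by decide)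
  have hne₃₁ : P₃ ≠ P₁ := hnd.injective.ne (show (2 : Fin 3) ≠ 0 by decide)
  obtain ⟨hu, hv, husq, hvsq, hdet⟩ := unit_vectors_of_unit_pairwise_sums
    (by simpa only [div_pow] using hP₁) (by simpa only [div_pow] using hP₂)
    (by simpa only [div_pow] using hP₃) (midpoint_mem_of_isTangentLine hne₁₂ hP₁ hP₂ ht₁₂)
    (midpoint_mem_of_isTangentLine hne₂₃ hP₂ hP₃ ht₂₃)
    (midpoint_mem_of_isTangentLine hne₃₁ hP₃ hP₁ ht₃₁)
  have hx : P₁ 0 + P₂ 0 + P₃ 0 = 0 := by field_simp at hu; linarith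
  have hy : P₁ 1 + P₂ 1 + P₃ 1 = 0 := by field_simp at hv; linarith
  have hxsq : P₁ 0 ^ 2 + P₂ 0 ^ 2 + P₃ 0 ^ 2 = 3 / 2 * a ^ 2 := by
    field_simp at husq; linarith
  have hysq : P₁ 1 ^ 2 + P₂ 1 ^ 2 + P₃ 1 ^ 2 = 3 / 2 * b ^ 2 := by
    field_simp at hvsq; linarith
  have hdet' : P₁ 0 * P₂ 1 - P₂ 0 * P₁ 1 ≠ 0 := fun h => hdet (by field_simp; linarith)
  have hdist (X Y : Pt) : dist X Y ^ 2 = (X 0 - Y 0) ^ 2 + (X 1 - Y 1) ^ 2 := by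
    simp [EuclideanSpace.dist_sq_eq, Real.dist_eq, sq_abs]
  have hO₁' := hdist O P₁
  have hO₂' := hdist O P₂
  have hO₃' := hdist O P₃
  rw [hO₁] at hO₁'
  rw [hO₂] at hO₂'
  rw [hO₃] at hO₃'
  simp only [PiLp.inner_apply, Fin.sum_univ_two, PiLp.sub_apply, RCLike.inner_apply,
    conj_trivial] at hH₁ hH₂
  have hpow : O 0 ^ 2 + O 1 ^ 2 - R ^ 2 = -(a ^ 2 + b ^ 2) / 2 := by
    linear_combination (-hO₁' - hO₂' - hO₃' - hxsq - hysq + 2 * O 0 * hx + 2 * O 1 * hy) / 3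
  have hP₃x : P₃ 0 = -P₁ 0 - P₂ 0 := by linear_combination hx
  have hP₃y : P₃ 1 = -P₁ 1 - P₂ 1 := by linear_combination hy
  rw [hP₃x, hP₃y] at hH₁ hH₂ hO₃'
  have hperp₁ : (H 0 + 2 * O 0) * (P₁ 0 + 2 * P₂ 0) + (H 1 + 2 * O 1) * (P₁ 1 + 2 * P₂ 1) = 0 := by
    linear_combination hH₁ + hO₂' - hO₃'
  have hperp₂ : (H 0 + 2 * O 0) * (2 * P₁ 0 + P₂ 0) + (H 1 + 2 * O 1) * (2 * P₁ 1 + P₂ 1) = 0 := by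
    linear_combination -hH₂ + hO₁' - hO₃'
  have hHx : H 0 = -2 * O 0 := by
    have : (P₁ 0 * P₂ 1 - P₂ 0 * P₁ 1) * (H 0 + 2 * O 0) = 0 := by
      linear_combination
        ((2 * P₁ 1 + P₂ 1) * hperp₁ - (P₁ 1 + 2 * P₂ 1) * hperp₂) / (-3)
    linarith [(mul_eq_zero.1 this).resolve_left hdet']
  have hHy : H 1 = -2 * O 1 := by
    have : (P₁ 0 * P₂ 1 - P₂ 0 * P₁ 1) * (H 1 + 2 * O 1) = 0 := by
      linear_combination
        ((2 * P₁ 0 + P₂ 0) * hperp₁ - (P₁ 0 + 2 * P₂ 0) * hperp₂) / 3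
    linarith [(mul_eq_zero.1 this).resolve_left hdet']
  have hmid (i : Fin 2) : midpoint ℝ O H i = (O i + H i) / 2 := by
    simp [midpoint_eq_smul_add]; ring
  simp only [circlePower, hdist, hmid, hHx, hHy, PiLp.zero_apply]
  exact ⟨by linear_combination hpow, by linear_combination hpow / 4⟩
end
end

section
/- Let a > b > 0, c² = a² − b², δ = √(a⁴ − a²b² + b⁴), and let the confocal caustic have semi-axes a_c = a(δ − b²)/c² and b_c = b(a² − δ)/c². Let E = {(x,y) ∈ ℝ² : x²/a² + y²/b² = 1} and E_c = {(x,y) ∈ ℝ² : x²/a_c² + y²/b_c² = 1}. Then for every triangle with vertices on E that circumscribes E_c (a billiard 3-periodic), the power of the origin with respect to the Bevan circle of the triangle (the circumcircle of its excentral triangle) equals −a² − b² − 2δ. -/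
open scoped RealInnerProductSpace

noncomputable section

/-- A real quadratic with exactly one root has vanishing discriminant. -/
lemma sq_eq_mul_of_existsUnique_root {A B C t₀ : ℝ} (hA : A ≠ 0)
    (h₀ : A * t₀ ^ 2 + 2 * B * t₀ + C = 0)
    (huniq : ∀ t, A * t ^ 2 + 2 * B * t + C = 0 → t = t₀) : B ^ 2 = A * C := by
  have h := huniq (-2 * B / A - t₀) (by field_simp; linear_combination A * h₀)
  have hB : B = -A * t₀ := by
    field_simp at h
    linarith
  subst hB
  linear_combination -A * h₀

/-- A chord of the unit circle that is tangent to the ellipse with semi-axes `α`, `β`,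
where `α + β = 1`, has endpoints conjugate with respect to a fixed conic. -/
lemma conjugate_of_tangent {α β x₁ y₁ x₂ y₂ t₀ : ℝ} (hα : 0 < α) (hβ : 0 < β)
    (hαβ : α + β = 1) (h₁ : x₁ ^ 2 + y₁ ^ 2 = 1) (h₂ : x₂ ^ 2 + y₂ ^ 2 = 1)
    (hne : ¬(x₁ = x₂ ∧ y₁ = y₂))
    (h₀ : (x₁ + t₀ * (x₂ - x₁)) ^ 2 / α ^ 2 + (y₁ + t₀ * (y₂ - y₁)) ^ 2 / β ^ 2 = 1)
    (huniq : ∀ t, (x₁ + t * (x₂ - x₁)) ^ 2 / α ^ 2 + (y₁ + t * (y₂ - y₁)) ^ 2 / β ^ 2 = 1 →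
      t = t₀) :
    β * (x₁ * x₂) + α * (y₁ * y₂) = -(α * β) := by
  have hC : 0 < 1 - (x₁ * x₂ + y₁ * y₂) := by
    by_contra! hle
    have hx : (x₁ - x₂) ^ 2 + (y₁ - y₂) ^ 2 ≤ 0 := by linarith
    exact hne ⟨by nlinarith [sq_nonneg (x₁ - x₂), sq_nonneg (y₁ - y₂)],
      by nlinarith [sq_nonneg (x₁ - x₂), sq_nonneg (y₁ - y₂)]⟩
  have hA : β ^ 2 * (x₂ - x₁) ^ 2 + α ^ 2 * (y₂ - y₁) ^ 2 ≠ 0 := by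
    intro hA
    have hx : β ^ 2 * (x₂ - x₁) ^ 2 = 0 :=
      le_antisymm (by nlinarith [sq_nonneg (α * (y₂ - y₁))]) (by positivity)
    have hy : α ^ 2 * (y₂ - y₁) ^ 2 = 0 := by linarith
    simp only [mul_eq_zero, pow_eq_zero_iff, ne_eq, OfNat.ofNat_ne_zero, not_false_eq_true,
      hβ.ne', hα.ne', false_or] at hx hy
    exact hne ⟨by linarith, by linarith⟩
  have hiff : ∀ t, (x₁ + t * (x₂ - x₁)) ^ 2 / α ^ 2 + (y₁ + t * (y₂ - y₁)) ^ 2 / β ^ 2 = 1 ↔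
      (β ^ 2 * (x₂ - x₁) ^ 2 + α ^ 2 * (y₂ - y₁) ^ 2) * t ^ 2 +
        2 * (β ^ 2 * (x₁ * (x₂ - x₁)) + α ^ 2 * (y₁ * (y₂ - y₁))) * t +
        (β ^ 2 * x₁ ^ 2 + α ^ 2 * y₁ ^ 2 - α ^ 2 * β ^ 2) = 0 := by
    intro t
    rw [div_add_div _ _ (by positivity) (by positivity), div_eq_one_iff_eq (by positivity),
      ← sub_eq_zero]
    ring_nf
  have hdisc := sq_eq_mul_of_existsUnique_root hA ((hiff t₀).1 h₀)
    fun t ht => huniq t ((hiff t).2 ht)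
  have hdisc' : β ^ 2 * (x₂ - x₁) ^ 2 + α ^ 2 * (y₂ - y₁) ^ 2 = (x₁ * y₂ - x₂ * y₁) ^ 2 := by
    have : α ^ 2 * β ^ 2 ≠ 0 := by positivity
    apply mul_left_cancel₀ this
    linear_combination hdisc
  have hx : (x₂ - x₁) ^ 2 = (1 - (x₁ * x₂ + y₁ * y₂)) * (1 - (x₁ * x₂ - y₁ * y₂)) := by
    linear_combination y₂ ^ 2 * h₁ + (1 - x₁ ^ 2) * h₂
  have hy : (y₂ - y₁) ^ 2 = (1 - (x₁ * x₂ + y₁ * y₂)) * (1 + (x₁ * x₂ - y₁ * y₂)) := by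
    linear_combination x₂ ^ 2 * h₁ + (1 - y₁ ^ 2) * h₂
  have hxy : (x₁ * y₂ - x₂ * y₁) ^ 2 =
      (1 - (x₁ * x₂ + y₁ * y₂)) * (1 + (x₁ * x₂ + y₁ * y₂)) := by
    linear_combination (x₂ ^ 2 + y₂ ^ 2) * h₁ + h₂
  rw [hx, hy, hxy] at hdisc'
  have hlin : β ^ 2 * (1 - (x₁ * x₂ - y₁ * y₂)) + α ^ 2 * (1 + (x₁ * x₂ - y₁ * y₂)) =
      1 + (x₁ * x₂ + y₁ * y₂) := by
    apply mul_left_cancel₀ hC.ne'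
    linear_combination hdisc'
  obtain rfl : α = 1 - β := by linarith
  linear_combination -hlin / 2

/-- If `(x₂, y₂) ≠ (x₃, y₃)` on the unit circle are conjugate to `(x₁, y₁)`, their sum is
normal to the line joining them. -/
lemma add_parallel_of_conjugate {α β x₁ y₁ x₂ y₂ x₃ y₃ : ℝ}
    (h₂ : x₂ ^ 2 + y₂ ^ 2 = 1) (h₃ : x₃ ^ 2 + y₃ ^ 2 = 1)
    (hne : ¬(x₂ = x₃ ∧ y₂ = y₃))
    (h₁₂ : β * (x₁ * x₂) + α * (y₁ * y₂) = -(α * β))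
    (h₃₁ : β * (x₃ * x₁) + α * (y₃ * y₁) = -(α * β)) :
    β * x₁ * (y₂ + y₃) = α * y₁ * (x₂ + x₃) := by
  rw [← sub_eq_zero]
  by_contra hdet
  refine hne ⟨?_, ?_⟩
  · rw [← sub_eq_zero]
    apply (mul_eq_zero.1 _).resolve_left hdet
    linear_combination (y₂ + y₃) * (h₁₂ - h₃₁) - α * y₁ * (h₂ - h₃)
  · rw [← sub_eq_zero]
    apply (mul_eq_zero.1 _).resolve_left hdet
    linear_combination β * x₁ * (h₂ - h₃) - (x₂ + x₃) * (h₁₂ - h₃₁)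

/-- The length of a chord of the ellipse tangent to the confocal caustic. -/
lemma chord_length {a b α β t x₁ y₁ x₂ y₂ : ℝ} (ht : 0 ≤ t) (hαβ : α + β = 1)
    (ha : a ^ 2 = t * (α * (1 + β))) (hb : b ^ 2 = t * (β * (1 + α)))
    (h₁ : x₁ ^ 2 + y₁ ^ 2 = 1) (h₂ : x₂ ^ 2 + y₂ ^ 2 = 1)
    (h₁₂ : β * (x₁ * x₂) + α * (y₁ * y₂) = -(α * β)) :
    √((a * x₁ - a * x₂) ^ 2 + (b * y₁ - b * y₂) ^ 2) = √t * (1 - (x₁ * x₂ + y₁ * y₂)) := by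
  have hC : 0 ≤ 1 - (x₁ * x₂ + y₁ * y₂) := by
    nlinarith [sq_nonneg (x₁ - x₂), sq_nonneg (y₁ - y₂)]
  have hsq : (a * x₁ - a * x₂) ^ 2 + (b * y₁ - b * y₂) ^ 2 =
      t * (1 - (x₁ * x₂ + y₁ * y₂)) ^ 2 := by
    have hx : (x₁ - x₂) ^ 2 = (1 - (x₁ * x₂ + y₁ * y₂)) * (1 - (x₁ * x₂ - y₁ * y₂)) := by
      linear_combination y₂ ^ 2 * h₁ + (1 - x₁ ^ 2) * h₂
    have hy : (y₁ - y₂) ^ 2 = (1 - (x₁ * x₂ + y₁ * y₂)) * (1 + (x₁ * x₂ - y₁ * y₂)) := by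
      linear_combination x₂ ^ 2 * h₁ + (1 - y₁ ^ 2) * h₂
    have hw : α * (1 + β) * (1 - (x₁ * x₂ - y₁ * y₂)) +
        β * (1 + α) * (1 + (x₁ * x₂ - y₁ * y₂)) = 1 - (x₁ * x₂ + y₁ * y₂) := by
      obtain rfl : α = 1 - β := by linarith
      linear_combination 2 * h₁₂
    calc _ = a ^ 2 * (x₁ - x₂) ^ 2 + b ^ 2 * (y₁ - y₂) ^ 2 := by ring
      _ = t * (1 - (x₁ * x₂ + y₁ * y₂)) * (α * (1 + β) * (1 - (x₁ * x₂ - y₁ * y₂)) +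
          β * (1 + α) * (1 + (x₁ * x₂ - y₁ * y₂))) := by rw [ha, hb, hx, hy]; ring
      _ = _ := by rw [hw]; ring
  rw [hsq, Real.sqrt_mul ht, Real.sqrt_sq hC]

/-- A point of a pairwise conjugate triple on the unit circle lies on the conic that cuts the
circle in the triple and a fourth point. -/
lemma mem_conic_of_conjugate {α β x₁ y₁ x₂ y₂ x₃ y₃ : ℝ} (hαβ : α + β = 1)
    (h₁ : x₁ ^ 2 + y₁ ^ 2 = 1)
    (h₁₂ : β * (x₁ * x₂) + α * (y₁ * y₂) = -(α * β))
    (h₃₁ : β * (x₃ * x₁) + α * (y₃ * y₁) = -(α * β)) :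
    (α - β) * x₁ ^ 2 + β * (x₁ + x₂ + x₃) * x₁ + α * (y₁ + y₂ + y₃) * y₁ =
      (α - β) * α := by
  obtain rfl : α = 1 - β := by linarith
  linear_combination h₁₂ + h₃₁ + (1 - β) * h₁

/-- The centroid of a pairwise conjugate triple on the unit circle lies on a fixed circle. -/
lemma sum_sq_of_conjugate {α β x₁ y₁ x₂ y₂ x₃ y₃ : ℝ} (hα : 0 < α) (hβ : 0 < β)
    (hαβ : α + β = 1) (h₁ : x₁ ^ 2 + y₁ ^ 2 = 1)
    (h₁₂ : β * (x₁ * x₂) + α * (y₁ * y₂) = -(α * β))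
    (h₃₁ : β * (x₃ * x₁) + α * (y₃ * y₁) = -(α * β))
    (g₁ : β * x₁ * (y₂ + y₃) = α * y₁ * (x₂ + x₃)) :
    (x₁ + x₂ + x₃) ^ 2 + (y₁ + y₂ + y₃) ^ 2 = (α - β) ^ 2 := by
  have f₁ := mem_conic_of_conjugate hαβ h₁ h₁₂ h₃₁
  have hD : β ^ 2 * x₁ ^ 2 + α ^ 2 * y₁ ^ 2 ≠ 0 := by
    intro hD
    have hx : β ^ 2 * x₁ ^ 2 = 0 :=
      le_antisymm (by nlinarith [sq_nonneg (α * y₁)]) (by positivity)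
    have hy : α ^ 2 * y₁ ^ 2 = 0 := by linarith
    simp only [mul_eq_zero, pow_eq_zero_iff, ne_eq, OfNat.ofNat_ne_zero, not_false_eq_true,
      hβ.ne', hα.ne', false_or] at hx hy
    simp [hx, hy] at h₁
  have g₁' : β * x₁ * (y₁ + y₂ + y₃) - α * y₁ * (x₁ + x₂ + x₃) = -((α - β) * (x₁ * y₁)) := by
    linear_combination g₁
  have f₁' : β * x₁ * (x₁ + x₂ + x₃) + α * y₁ * (y₁ + y₂ + y₃) = (α - β) * (α - x₁ ^ 2) := by
    linear_combination f₁
  generalize x₁ + x₂ + x₃ = p at *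
  generalize y₁ + y₂ + y₃ = q at *
  have key : (β ^ 2 * x₁ ^ 2 + α ^ 2 * y₁ ^ 2) * (p ^ 2 + q ^ 2) =
      (α - β) ^ 2 * ((α - x₁ ^ 2) ^ 2 + (x₁ * y₁) ^ 2) := by
    linear_combination (β * x₁ * p + α * y₁ * q + (α - β) * (α - x₁ ^ 2)) * f₁' +
      (β * x₁ * q - α * y₁ * p - (α - β) * (x₁ * y₁)) * g₁'
  apply mul_left_cancel₀ hD
  rw [key]
  obtain rfl : α = 1 - β := by linarith
  linear_combination (1 - β - β) ^ 2 * (x₁ ^ 2 - (1 - β) ^ 2) * h₁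

/-- The power of the origin with respect to the Bevan circle, in coordinates scaled by the
semi-axes of the outer ellipse. -/
lemma bevan_power_of_conjugate {a b α β t x₁ y₁ x₂ y₂ x₃ y₃ u v R s₁ s₂ s₃ : ℝ}
    (ha₀ : 0 < a) (hb₀ : 0 < b) (hα : 0 < α) (hβ : 0 < β) (ht : 0 < t)
    (hαβ : α + β = 1) (hne : α ≠ β)
    (ha : a ^ 2 = t * (α * (1 + β))) (hb : b ^ 2 = t * (β * (1 + α)))
    (h₁ : x₁ ^ 2 + y₁ ^ 2 = 1) (h₂ : x₂ ^ 2 + y₂ ^ 2 = 1) (h₃ : x₃ ^ 2 + y₃ ^ 2 = 1)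
    (h₁₂ : β * (x₁ * x₂) + α * (y₁ * y₂) = -(α * β))
    (h₂₃ : β * (x₂ * x₃) + α * (y₂ * y₃) = -(α * β))
    (h₃₁ : β * (x₃ * x₁) + α * (y₃ * y₁) = -(α * β))
    (n₁₂ : ¬(x₁ = x₂ ∧ y₁ = y₂)) (n₂₃ : ¬(x₂ = x₃ ∧ y₂ = y₃)) (n₃₁ : ¬(x₃ = x₁ ∧ y₃ = y₁))
    (hncol : ∀ e f : ℝ, e * (a * x₂ - a * x₁) + f * (b * y₂ - b * y₁) = 0 →
      e * (a * x₃ - a * x₁) + f * (b * y₃ - b * y₁) = 0 → e = 0 ∧ f = 0)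
    (hs₁ : s₁ = √t * (1 - (x₂ * x₃ + y₂ * y₃)))
    (hs₂ : s₂ = √t * (1 - (x₃ * x₁ + y₃ * y₁)))
    (hs₃ : s₃ = √t * (1 - (x₁ * x₂ + y₁ * y₂)))
    (hO₁ : (u - a * x₁) ^ 2 + (v - b * y₁) ^ 2 = R ^ 2)
    (hO₂ : (u - a * x₂) ^ 2 + (v - b * y₂) ^ 2 = R ^ 2)
    (hO₃ : (u - a * x₃) ^ 2 + (v - b * y₃) ^ 2 = R ^ 2) :
    (2 * u - (s₁ + s₂ + s₃)⁻¹ * (s₁ * (a * x₁) + s₂ * (a * x₂) + s₃ * (a * x₃))) ^ 2 +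
      (2 * v - (s₁ + s₂ + s₃)⁻¹ * (s₁ * (b * y₁) + s₂ * (b * y₂) + s₃ * (b * y₃))) ^ 2 -
      (2 * R) ^ 2 = -(3 * t) := by
  have g₁ := add_parallel_of_conjugate h₂ h₃ n₂₃ h₁₂ h₃₁
  have g₂ := add_parallel_of_conjugate h₃ h₁ n₃₁ h₂₃ h₁₂
  have g₃ := add_parallel_of_conjugate h₁ h₂ n₁₂ h₃₁ h₂₃
  have hpq := sum_sq_of_conjugate hα hβ hαβ h₁ h₁₂ h₃₁ g₁
  have f₁ := mem_conic_of_conjugate hαβ h₁ h₁₂ h₃₁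
  have f₂ := mem_conic_of_conjugate hαβ h₂ h₂₃ h₁₂
  have f₃ := mem_conic_of_conjugate hαβ h₃ h₃₁ h₂₃
  obtain ⟨p, hp⟩ : ∃ p, p = x₁ + x₂ + x₃ := ⟨_, rfl⟩
  obtain ⟨q, hq⟩ : ∃ q, q = y₁ + y₂ + y₃ := ⟨_, rfl⟩
  rw [← hp, ← hq] at hpq
  rw [show x₂ + x₃ + x₁ = p by rw [hp]; ring, show y₂ + y₃ + y₁ = q by rw [hq]; ring] at f₂
  rw [show x₃ + x₁ + x₂ = p by rw [hp]; ring, show y₃ + y₁ + y₂ = q by rw [hq]; ring] at f₃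
  rw [← hp, ← hq] at f₁
  rw [show y₂ + y₃ = q - y₁ by rw [hq]; ring, show x₂ + x₃ = p - x₁ by rw [hp]; ring] at g₁
  rw [show y₃ + y₁ = q - y₂ by rw [hq]; ring, show x₃ + x₁ = p - x₂ by rw [hp]; ring] at g₂
  rw [show y₁ + y₂ = q - y₃ by rw [hq]; ring, show x₁ + x₂ = p - x₃ by rw [hp]; ring] at g₃
  have hk : α - β ≠ 0 := sub_ne_zero.2 hne
  have hxy : x₁ * y₁ + x₂ * y₂ + x₃ * y₃ = p * q := by
    apply mul_left_cancel₀ hk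
    linear_combination g₁ + g₂ + g₃ + (β * q) * hp - (α * p) * hq
  have hxx : x₁ ^ 2 + x₂ ^ 2 + x₃ ^ 2 = p ^ 2 + α * (3 - (α - β)) := by
    apply mul_left_cancel₀ hk
    linear_combination f₁ + f₂ + f₃ + (β * p) * hp + (α * q) * hq - α * hpq
  have hyy : y₁ ^ 2 + y₂ ^ 2 + y₃ ^ 2 = 3 - p ^ 2 - α * (3 - (α - β)) := by
    linear_combination h₁ + h₂ + h₃ - hxx
  have w₁ : 1 - (x₂ * x₃ + y₂ * y₃) = (3 - (α - β) ^ 2) / 2 + p * x₁ + q * y₁ := by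
    rw [← hpq, hp, hq]
    linear_combination (h₁ + h₂ + h₃) / 2 - h₁
  have w₂ : 1 - (x₃ * x₁ + y₃ * y₁) = (3 - (α - β) ^ 2) / 2 + p * x₂ + q * y₂ := by
    rw [← hpq, hp, hq]
    linear_combination (h₁ + h₂ + h₃) / 2 - h₂
  have w₃ : 1 - (x₁ * x₂ + y₁ * y₂) = (3 - (α - β) ^ 2) / 2 + p * x₃ + q * y₃ := by
    rw [← hpq, hp, hq]
    linear_combination (h₁ + h₂ + h₃) / 2 - h₃
  rw [w₁] at hs₁
  rw [w₂] at hs₂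
  rw [w₃] at hs₃
  have hsum : s₁ + s₂ + s₃ = √t * (2 * (1 + α) * (1 + β)) := by
    rw [hs₁, hs₂, hs₃]
    obtain rfl : α = 1 - β := by linarith
    linear_combination √t * (hpq - p * hp - q * hq)
  have hsx : s₁ * x₁ + s₂ * x₂ + s₃ * x₃ = √t * (2 * (1 + α) * p) := by
    rw [hs₁, hs₂, hs₃]
    obtain rfl : α = 1 - β := by linarith
    linear_combination √t * (p * hxx + q * hxy + p * hpq - (3 - (1 - β - β) ^ 2) / 2 * hp)
  have hsy : s₁ * y₁ + s₂ * y₂ + s₃ * y₃ = √t * (2 * (1 + β) * q) := by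
    rw [hs₁, hs₂, hs₃]
    obtain rfl : α = 1 - β := by linarith
    linear_combination √t * (q * hyy + p * hxy - (3 - (1 - β - β) ^ 2) / 2 * hq)
  have hst : √t ≠ 0 := (Real.sqrt_pos.2 ht).ne'
  have hα' : 1 + α ≠ 0 := by positivity
  have hβ' : 1 + β ≠ 0 := by positivity
  have hIx : (s₁ + s₂ + s₃)⁻¹ * (s₁ * (a * x₁) + s₂ * (a * x₂) + s₃ * (a * x₃)) =
      a * p / (1 + β) := by
    rw [show s₁ * (a * x₁) + s₂ * (a * x₂) + s₃ * (a * x₃) =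
      a * (s₁ * x₁ + s₂ * x₂ + s₃ * x₃) by ring, hsx, hsum]
    field_simp
  have hIy : (s₁ + s₂ + s₃)⁻¹ * (s₁ * (b * y₁) + s₂ * (b * y₂) + s₃ * (b * y₃)) =
      b * q / (1 + α) := by
    rw [show s₁ * (b * y₁) + s₂ * (b * y₂) + s₃ * (b * y₃) =
      b * (s₁ * y₁ + s₂ * y₂ + s₃ * y₃) by ring, hsy, hsum]
    field_simp
  have hcirc : ∀ x y : ℝ, x ^ 2 + y ^ 2 = 1 →
      (α - β) * x ^ 2 + β * p * x + α * q * y = (α - β) * α →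
      (a * x) ^ 2 + (b * y) ^ 2 + t * β * p * x + t * α * q * y =
        t * (α ^ 2 * (1 + β) + β ^ 2 * (1 + α)) := by
    intro x y h f
    rw [mul_pow, mul_pow, ha, hb]
    obtain rfl : α = 1 - β := by linarith
    linear_combination t * f + t * β * (2 - β) * h
  have c₁ := hcirc _ _ h₁ f₁
  have c₂ := hcirc _ _ h₂ f₂
  have c₃ := hcirc _ _ h₃ f₃
  obtain ⟨hu, hv⟩ := hncol (2 * u + t * β * p / a) (2 * v + t * α * q / b)
    (by field_simp; linear_combination hO₁ - hO₂ + c₂ - c₁)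
    (by field_simp; linear_combination hO₁ - hO₃ + c₃ - c₁)
  have hua : 2 * (u * a) = -(t * β * p) := by
    field_simp at hu
    linarith
  have hvb : 2 * (v * b) = -(t * α * q) := by
    field_simp at hv
    linarith
  have hR : R ^ 2 = u ^ 2 + v ^ 2 + t * (α ^ 2 * (1 + β) + β ^ 2 * (1 + α)) := by
    linear_combination -hO₁ + c₁ - x₁ * hua - y₁ * hvb
  rw [hIx, hIy]
  calc _ = -4 * t * (α ^ 2 * (1 + β) + β ^ 2 * (1 + α)) - 2 * (2 * (u * a)) * p / (1 + β) -
        2 * (2 * (v * b)) * q / (1 + α) + a ^ 2 * p ^ 2 / (1 + β) ^ 2 +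
        b ^ 2 * q ^ 2 / (1 + α) ^ 2 := by
        rw [mul_pow 2 R, hR]
        field_simp
        ring
    _ = -4 * t * (α ^ 2 * (1 + β) + β ^ 2 * (1 + α)) +
        t * p ^ 2 * (2 * β + α) / (1 + β) + t * q ^ 2 * (2 * α + β) / (1 + α) := by
        rw [hua, hvb, ha, hb]
        field_simp
        ring
    _ = -4 * t * (α ^ 2 * (1 + β) + β ^ 2 * (1 + α)) + t * (p ^ 2 + q ^ 2) := by
        rw [show 2 * β + α = 1 + β by linarith, show 2 * α + β = 1 + α by linarith]
        field_simp
        ring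
    _ = -(3 * t) := by
        rw [hpq]
        obtain rfl : α = 1 - β := by linarith
        ring

/-- In the plane, no nonzero vector is orthogonal to two sides of a nondegenerate triangle. -/
lemma eq_zero_of_orthogonal_sides_s7 {P₁ P₂ P₃ : Pt} (hnd : AffineIndependent ℝ ![P₁, P₂, P₃])
    {e f : ℝ} (h₂ : e * (P₂ 0 - P₁ 0) + f * (P₂ 1 - P₁ 1) = 0)
    (h₃ : e * (P₃ 0 - P₁ 0) + f * (P₃ 1 - P₁ 1) = 0) : e = 0 ∧ f = 0 := by
  by_contra hef
  have hpos : e ^ 2 + f ^ 2 ≠ 0 := by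
    intro h
    exact hef ⟨by nlinarith [sq_nonneg e, sq_nonneg f], by nlinarith [sq_nonneg e, sq_nonneg f]⟩
  have hline : ∀ P : Pt, e * (P 0 - P₁ 0) + f * (P 1 - P₁ 1) = 0 →
      ∃ r : ℝ, P = r • (!₂[-f, e] : Pt) +ᵥ P₁ := by
    intro P hP
    refine ⟨(-f * (P 0 - P₁ 0) + e * (P 1 - P₁ 1)) / (e ^ 2 + f ^ 2), ?_⟩
    ext i
    fin_cases i
    · simp
      field_simp
      linear_combination e * hP
    · simp
      field_simp
      linear_combination f * hP
  rw [affineIndependent_iff_not_collinear_set] at hnd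
  refine hnd ((collinear_iff_of_mem (p₀ := P₁) (by simp)).2 ⟨!₂[-f, e], ?_⟩)
  simp only [Set.mem_insert_iff, Set.mem_singleton_iff, forall_eq_or_imp, forall_eq]
  exact ⟨hline _ (by ring), hline _ h₂, hline _ h₃⟩

/-- A tangent sideline with vertices on the outer ellipse has conjugate endpoints. -/
lemma conjugate_of_isTangentLine {a b α β x₁ y₁ x₂ y₂ : ℝ} {P Q : Pt} (ha : 0 < a) (hb : 0 < b)
    (hα : 0 < α) (hβ : 0 < β) (hαβ : α + β = 1)
    (hP₀ : P 0 = a * x₁) (hP₁ : P 1 = b * y₁) (hQ₀ : Q 0 = a * x₂) (hQ₁ : Q 1 = b * y₂)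
    (h₁ : x₁ ^ 2 + y₁ ^ 2 = 1) (h₂ : x₂ ^ 2 + y₂ ^ 2 = 1) (hne : ¬(x₁ = x₂ ∧ y₁ = y₂))
    (htan : IsTangentLine (sideline P Q)
      {X : Pt | (X 0) ^ 2 / (a * α) ^ 2 + (X 1) ^ 2 / (b * β) ^ 2 = 1}) :
    β * (x₁ * x₂) + α * (y₁ * y₂) = -(α * β) := by
  have hiff : ∀ t : ℝ, P + t • (Q - P) ∈
      {X : Pt | (X 0) ^ 2 / (a * α) ^ 2 + (X 1) ^ 2 / (b * β) ^ 2 = 1} ↔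
      (x₁ + t * (x₂ - x₁)) ^ 2 / α ^ 2 + (y₁ + t * (y₂ - y₁)) ^ 2 / β ^ 2 = 1 := by
    intro t
    simp only [Set.mem_ofPred_eq, PiLp.add_apply, PiLp.smul_apply, PiLp.sub_apply, smul_eq_mul,
      hP₀, hP₁, hQ₀, hQ₁]
    rw [show a * x₁ + t * (a * x₂ - a * x₁) = a * (x₁ + t * (x₂ - x₁)) by ring,
      show b * y₁ + t * (b * y₂ - b * y₁) = b * (y₁ + t * (y₂ - y₁)) by ring,
      mul_pow a, mul_pow a, mul_pow b, mul_pow b,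
      mul_div_mul_left _ _ (by positivity), mul_div_mul_left _ _ (by positivity)]
  obtain ⟨X, ⟨⟨t₀, rfl⟩, hX⟩, huniq⟩ := htan
  refine conjugate_of_tangent hα hβ hαβ h₁ h₂ hne ((hiff t₀).1 hX) fun t ht => ?_
  have hPQ : Q - P ≠ 0 := by
    intro h
    rw [sub_eq_zero] at h
    subst h
    exact hne ⟨mul_left_cancel₀ ha.ne' (hP₀.symm.trans hQ₀),
      mul_left_cancel₀ hb.ne' (hP₁.symm.trans hQ₁)⟩
  have := huniq _ ⟨⟨t, rfl⟩, (hiff t).2 ht⟩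
  exact smul_left_injective ℝ hPQ (add_left_cancel this)

/-- Points of an ellipse, in coordinates scaled by its semi-axes. -/
lemma exists_scaled_coords {a b : ℝ} (ha : a ≠ 0) (hb : b ≠ 0) {P : Pt}
    (hP : (P 0) ^ 2 / a ^ 2 + (P 1) ^ 2 / b ^ 2 = 1) :
    ∃ x y : ℝ, P 0 = a * x ∧ P 1 = b * y ∧ x ^ 2 + y ^ 2 = 1 :=
  ⟨P 0 / a, P 1 / b, by field_simp, by field_simp, by rw [div_pow, div_pow, hP]⟩

lemma Pt.dist_eq (P Q : Pt) : dist P Q = √((P 0 - Q 0) ^ 2 + (P 1 - Q 1) ^ 2) := by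
  simp [EuclideanSpace.dist_eq, Real.dist_eq]

lemma Pt.dist_sq (P Q : Pt) : dist P Q ^ 2 = (P 0 - Q 0) ^ 2 + (P 1 - Q 1) ^ 2 := by
  rw [Pt.dist_eq, Real.sq_sqrt (by positivity)]

/-- The semi-axes of the confocal caustic relative to those of the outer ellipse. -/
lemma caustic_ratios {a b c δ : ℝ} (hab : a > b) (hb : 0 < b) (hc : c ^ 2 = a ^ 2 - b ^ 2)
    (hδ : δ = √(a ^ 4 - a ^ 2 * b ^ 2 + b ^ 4)) :
    ∃ α β : ℝ, 0 < α ∧ 0 < β ∧ α + β = 1 ∧ α ≠ β ∧ a * (δ - b ^ 2) / c ^ 2 = a * α ∧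
      b * (a ^ 2 - δ) / c ^ 2 = b * β ∧ 0 < a ^ 2 + b ^ 2 + 2 * δ ∧
      a ^ 2 = (a ^ 2 + b ^ 2 + 2 * δ) / 3 * (α * (1 + β)) ∧
      b ^ 2 = (a ^ 2 + b ^ 2 + 2 * δ) / 3 * (β * (1 + α)) := by
  have ha : 0 < a := hb.trans hab
  have hlt : b ^ 2 < a ^ 2 := by gcongr
  have hδ₀ : 0 ≤ δ := hδ ▸ Real.sqrt_nonneg _
  have hδ₂ : δ ^ 2 = a ^ 4 - a ^ 2 * b ^ 2 + b ^ 4 := by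
    rw [hδ, Real.sq_sqrt (by nlinarith [sq_nonneg (a ^ 2 - b ^ 2), sq_nonneg (a * b)])]
  have ha₂ : 0 < a ^ 2 := by positivity
  have hb₂ : 0 < b ^ 2 := by positivity
  have hc₀ : 0 < c ^ 2 := by linarith
  have hδb : b ^ 2 < δ := by
    apply lt_of_pow_lt_pow_left₀ 2 hδ₀
    nlinarith [mul_pos ha₂ (sub_pos.2 hlt)]
  have hδa : δ < a ^ 2 := by
    apply lt_of_pow_lt_pow_left₀ 2 ha₂.le
    nlinarith [mul_pos hb₂ (sub_pos.2 hlt)]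
  have hc₁ : a ^ 2 - b ^ 2 ≠ 0 := by linarith
  refine ⟨(δ - b ^ 2) / c ^ 2, (a ^ 2 - δ) / c ^ 2, div_pos (by linarith) hc₀,
    div_pos (by linarith) hc₀, ?_, ?_, by ring, by ring, by linarith, ?_, ?_⟩
  · rw [hc]
    field_simp
    ring
  · rw [Ne, div_left_inj' hc₀.ne']
    intro h
    have : 0 < (a ^ 2 - b ^ 2) ^ 2 := by positivity
    nlinarith [show δ = (a ^ 2 + b ^ 2) / 2 by linarith]
  · rw [hc]
    field_simp
    linear_combination (2 * δ - 3 * a ^ 2 + b ^ 2) * hδ₂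
  · rw [hc]
    field_simp
    linear_combination (2 * δ - 3 * b ^ 2 + a ^ 2) * hδ₂

/-- invariant power of the center wrt the Bevan circle, confocal pair.
For the confocal pair with `δ = √(a⁴ − a²b² + b⁴)`, `a_c = a(δ − b²)/c²`,
`b_c = b(a² − δ)/c²`, every billiard 3-periodic has power of the origin wrt its Bevan
circle (center `2O − I`, radius `2R`) equal to `−a² − b² − 2δ`. -/
theorem power_center_confocal_bevan
    (a b c δ a_c b_c : ℝ)
    (hab : a > b) (hb : 0 < b)
    (hc : c ^ 2 = a ^ 2 - b ^ 2)
    (hδ : δ = Real.sqrt (a ^ 4 - a ^ 2 * b ^ 2 + b ^ 4))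
    (hac : a_c = a * (δ - b ^ 2) / c ^ 2)
    (hbc : b_c = b * (a ^ 2 - δ) / c ^ 2)
    (E E_c : Set Pt)
    (hE : E = {P : Pt | (P 0) ^ 2 / a ^ 2 + (P 1) ^ 2 / b ^ 2 = 1})
    (hEc : E_c = {P : Pt | (P 0) ^ 2 / a_c ^ 2 + (P 1) ^ 2 / b_c ^ 2 = 1})
    (P₁ P₂ P₃ : Pt)
    (hP₁ : P₁ ∈ E) (hP₂ : P₂ ∈ E) (hP₃ : P₃ ∈ E)
    (hnd : AffineIndependent ℝ ![P₁, P₂, P₃])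
    (hcirc : Circumscribes P₁ P₂ P₃ E_c)
    -- sidelengths
    (s₁ s₂ s₃ : ℝ)
    (hs₁ : s₁ = dist P₂ P₃) (hs₂ : s₂ = dist P₃ P₁) (hs₃ : s₃ = dist P₁ P₂)
    -- incenter
    (I : Pt)
    (hI : I = (s₁ + s₂ + s₃)⁻¹ • (s₁ • P₁ + s₂ • P₂ + s₃ • P₃))
    -- circumcenter and circumradius
    (O : Pt) (R : ℝ)
    (hO₁ : dist O P₁ = R) (hO₂ : dist O P₂ = R) (hO₃ : dist O P₃ = R) :
    circlePower 0 ((2 : ℝ) • O - I) (2 * R) = -a ^ 2 - b ^ 2 - 2 * δ := by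
  have ha : 0 < a := hb.trans hab
  obtain ⟨α, β, hα, hβ, hαβ, hne, hac', hbc', ht, ha₂, hb₂⟩ := caustic_ratios hab hb hc hδ
  rw [hac'] at hac
  rw [hbc'] at hbc
  subst hac hbc hE hEc
  obtain ⟨x₁, y₁, hx₁, hy₁, h₁⟩ := exists_scaled_coords ha.ne' hb.ne' hP₁
  obtain ⟨x₂, y₂, hx₂, hy₂, h₂⟩ := exists_scaled_coords ha.ne' hb.ne' hP₂
  obtain ⟨x₃, y₃, hx₃, hy₃, h₃⟩ := exists_scaled_coords ha.ne' hb.ne' hP₃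
  have hinj : ∀ {P Q : Pt} {x y x' y' : ℝ}, P 0 = a * x → P 1 = b * y → Q 0 = a * x' →
      Q 1 = b * y' → P ≠ Q → ¬(x = x' ∧ y = y') := by
    rintro P Q x y _ _ hP hP' hQ hQ' hPQ ⟨rfl, rfl⟩
    apply hPQ
    ext i
    fin_cases i
    · exact hP.trans hQ.symm
    · exact hP'.trans hQ'.symm
  have n₁₂ := hinj hx₁ hy₁ hx₂ hy₂ <|
    hnd.injective.ne (show (0 : Fin 3) ≠ 1 by decide)
  have n₂₃ := hinj hx₂ hy₂ hx₃ hy₃ <|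
    hnd.injective.ne (show (1 : Fin 3) ≠ 2 by decide)
  have n₃₁ := hinj hx₃ hy₃ hx₁ hy₁ <|
    hnd.injective.ne (show (2 : Fin 3) ≠ 0 by decide)
  obtain ⟨t₁₂, t₂₃, t₃₁, -⟩ := hcirc
  have h₁₂ := conjugate_of_isTangentLine ha hb hα hβ hαβ hx₁ hy₁ hx₂ hy₂ h₁ h₂ n₁₂ t₁₂
  have h₂₃ := conjugate_of_isTangentLine ha hb hα hβ hαβ hx₂ hy₂ hx₃ hy₃ h₂ h₃ n₂₃ t₂₃
  have h₃₁ := conjugate_of_isTangentLine ha hb hα hβ hαβ hx₃ hy₃ hx₁ hy₁ h₃ h₁ n₃₁ t₃₁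
  have ht' : 0 < (a ^ 2 + b ^ 2 + 2 * δ) / 3 := by positivity
  rw [Pt.dist_eq, hx₂, hx₃, hy₂, hy₃, chord_length ht'.le hαβ ha₂ hb₂ h₂ h₃ h₂₃] at hs₁
  rw [Pt.dist_eq, hx₃, hx₁, hy₃, hy₁, chord_length ht'.le hαβ ha₂ hb₂ h₃ h₁ h₃₁] at hs₂
  rw [Pt.dist_eq, hx₁, hx₂, hy₁, hy₂, chord_length ht'.le hαβ ha₂ hb₂ h₁ h₂ h₁₂] at hs₃
  have hncol : ∀ e f : ℝ, e * (a * x₂ - a * x₁) + f * (b * y₂ - b * y₁) = 0 →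
      e * (a * x₃ - a * x₁) + f * (b * y₃ - b * y₁) = 0 → e = 0 ∧ f = 0 := by
    intro e f
    rw [← hx₁, ← hx₂, ← hx₃, ← hy₁, ← hy₂, ← hy₃]
    exact eq_zero_of_orthogonal_sides_s7 hnd
  have key := bevan_power_of_conjugate ha hb hα hβ ht' hαβ hne ha₂ hb₂ h₁ h₂ h₃ h₁₂ h₂₃ h₃₁
    n₁₂ n₂₃ n₃₁ hncol hs₁ hs₂ hs₃ (u := O 0) (v := O 1) (R := R)
    (by rw [← hx₁, ← hy₁, ← Pt.dist_sq, hO₁]) (by rw [← hx₂, ← hy₂, ← Pt.dist_sq, hO₂])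
    (by rw [← hx₃, ← hy₃, ← Pt.dist_sq, hO₃])
  rw [circlePower, Pt.dist_sq, hI]
  simp only [PiLp.zero_apply, PiLp.add_apply, PiLp.smul_apply, PiLp.sub_apply, smul_eq_mul,
    hx₁, hx₂, hx₃, hy₁, hy₂, hy₃, zero_sub, neg_sq]
  linear_combination key
end
end
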